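/- arXiv:2201.11004 — 6 statements merged into one kernel-verified Lean document; each statement's English description precedes it below -/
import Mathlib

section
/- Let p ≥ 3 be a prime and d ≥ 1. For each i, let a_i : (Fin d →₀ ℕ) → ℤ_p be a family of coefficients with ‖a_i(I)‖ → 0 along the cofinite filter, and define f : ℤ_p^d → ℤ_p^d by f(x)_i = ∑'_I a_i(I) · ∏_j x_j^{I_j}. Assume f ≡ id mod p, meaning that for all i and I, ‖a_i(I) − δ_I‖ ≤ 1/p where δ_I = 1 if I is the multi-index with a single 1 in position i and δ_I = 0 otherwise. If f^{∘N} = id for some integer N ≥ 1 (N-fold composition of f with itself equals the identity map), then f = id. -/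
section TateDiffeo

variable {p : ℕ} [Fact p.Prime] {d : ℕ}

/-- `h` is, modulo every power of `p`, equal to `c` times a polynomial function. -/
def IsPadicPolyLimit (c : ℤ_[p]) (h : (Fin d → ℤ_[p]) → ℤ_[p]) : Prop :=
  ∀ n : ℕ, ∃ P : MvPolynomial (Fin d) ℤ_[p], ∀ x, (p : ℤ_[p]) ^ n ∣ h x - c * MvPolynomial.eval x P

namespace IsPadicPolyLimit

variable {b c : ℤ_[p]} {h g : (Fin d → ℤ_[p]) → ℤ_[p]}

theorem zero : IsPadicPolyLimit c (0 : (Fin d → ℤ_[p]) → ℤ_[p]) :=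
  fun _ => ⟨0, fun x => by simp⟩

theorem add (hh : IsPadicPolyLimit c h) (hg : IsPadicPolyLimit c g) :
    IsPadicPolyLimit c (h + g) := fun n => by
  obtain ⟨P, hP⟩ := hh n
  obtain ⟨Q, hQ⟩ := hg n
  refine ⟨P + Q, fun x => ?_⟩
  convert dvd_add (hP x) (hQ x) using 1
  simp only [Pi.add_apply, map_add]
  ring

theorem smul (b : ℤ_[p]) (hh : IsPadicPolyLimit c h) : IsPadicPolyLimit (b * c) (b • h) :=
  fun n => by
    obtain ⟨P, hP⟩ := hh n
    refine ⟨P, fun x => ?_⟩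
    convert (hP x).mul_left b using 1
    simp only [Pi.smul_apply, smul_eq_mul]
    ring

theorem of_dvd (hbc : b ∣ c) (hh : IsPadicPolyLimit c h) : IsPadicPolyLimit b h := fun n => by
  obtain ⟨e, rfl⟩ := hbc
  obtain ⟨P, hP⟩ := hh n
  refine ⟨MvPolynomial.C e * P, fun x => ?_⟩
  simpa [mul_assoc] using hP x

theorem neg (hh : IsPadicPolyLimit c h) : IsPadicPolyLimit c (-h) := by
  simpa using (hh.smul (-1)).of_dvd (b := c) (by simp)

theorem sum {ι : Type*} (s : Finset ι) {h : ι → (Fin d → ℤ_[p]) → ℤ_[p]}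
    (hh : ∀ k ∈ s, IsPadicPolyLimit c (h k)) : IsPadicPolyLimit c (∑ k ∈ s, h k) :=
  Finset.sum_induction _ _ (fun _ _ => add) zero hh

theorem of_smul (hb : b ≠ 0) (hh : IsPadicPolyLimit (b * c) (b • h)) : IsPadicPolyLimit c h :=
  fun n => by
    have hp : Prime (p : ℤ_[p]) := PadicInt.prime_p
    obtain ⟨P, hP⟩ := hh (b.valuation + n)
    refine ⟨P, fun x => ?_⟩
    have hbv : (p : ℤ_[p]) ^ b.valuation * (PadicInt.unitCoeff hb : ℤ_[p]) = b := by
      rw [mul_comm]; exact (PadicInt.unitCoeff_spec hb).symm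
    have h1 := hP x
    have h2 : (b • h) x - b * c * MvPolynomial.eval x P
        = (p : ℤ_[p]) ^ b.valuation *
          ((PadicInt.unitCoeff hb : ℤ_[p]) * (h x - c * MvPolynomial.eval x P)) := by
      rw [← mul_assoc, hbv, Pi.smul_apply, smul_eq_mul]; ring
    rw [h2, pow_add, mul_dvd_mul_iff_left (pow_ne_zero _ hp.ne_zero)] at h1
    exact (Units.dvd_mul_left (u := PadicInt.unitCoeff hb)).1 h1

end IsPadicPolyLimit

theorem MvPolynomial.dvd_aeval_sub_aeval {R S σ : Type*} [CommRing R] [CommRing S] [Algebra R S]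
    (q : S) {x y : σ → S} (hxy : ∀ i, q ∣ x i - y i) (P : MvPolynomial σ R) :
    q ∣ MvPolynomial.aeval x P - MvPolynomial.aeval y P := by
  rw [← Ideal.mem_span_singleton, ← Ideal.Quotient.eq]
  have key : (Ideal.Quotient.mkₐ R (Ideal.span {q})).comp (MvPolynomial.aeval x)
      = (Ideal.Quotient.mkₐ R (Ideal.span {q})).comp (MvPolynomial.aeval y) := by
    ext i
    simpa [Ideal.Quotient.eq, Ideal.mem_span_singleton] using hxy i
  exact DFunLike.congr_fun key P

/-- The difference operator `h ↦ h ∘ f - h`. -/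
noncomputable def compDifference (f : (Fin d → ℤ_[p]) → (Fin d → ℤ_[p])) :
    Module.End ℤ_[p] ((Fin d → ℤ_[p]) → ℤ_[p]) :=
  LinearMap.funLeft ℤ_[p] ℤ_[p] f - 1

theorem compDifference_apply (f : (Fin d → ℤ_[p]) → (Fin d → ℤ_[p]))
    (h : (Fin d → ℤ_[p]) → ℤ_[p]) (x : Fin d → ℤ_[p]) :
    compDifference f h x = h (f x) - h x := rfl

theorem IsPadicPolyLimit.compDifference {f : (Fin d → ℤ_[p]) → (Fin d → ℤ_[p])}
    (hf : ∀ i, IsPadicPolyLimit (p : ℤ_[p]) fun x => f x i - x i)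
    {c : ℤ_[p]} {h : (Fin d → ℤ_[p]) → ℤ_[p]} (hh : IsPadicPolyLimit c h) :
    IsPadicPolyLimit ((p : ℤ_[p]) * c) (compDifference f h) := fun n => by
  obtain ⟨P, hP⟩ := hh n
  choose G hG using fun i => hf i n
  let y : Fin d → MvPolynomial (Fin d) ℤ_[p] := fun i => .X i + .C (p : ℤ_[p]) * G i
  obtain ⟨Q, hQ⟩ := MvPolynomial.dvd_aeval_sub_aeval (R := ℤ_[p]) (MvPolynomial.C (p : ℤ_[p]))
    (x := y) (y := MvPolynomial.X) (fun i => by simp [y]) P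
  refine ⟨Q, fun x => ?_⟩
  have hcomp : MvPolynomial.eval x (MvPolynomial.aeval y P)
      = MvPolynomial.eval (fun i => MvPolynomial.eval x (y i)) P := by
    rw [← MvPolynomial.coe_aeval_eq_eval, ← MvPolynomial.coe_aeval_eq_eval]
    exact MvPolynomial.comp_aeval_apply (φ := MvPolynomial.aeval x) (f := y) P
  have hQx := congrArg (MvPolynomial.eval x) hQ
  rw [map_sub, hcomp, MvPolynomial.aeval_X_left_apply, map_mul, MvPolynomial.eval_C] at hQx
  have hfy : (p : ℤ_[p]) ^ n ∣ MvPolynomial.eval (f x) P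
      - MvPolynomial.eval (fun i => MvPolynomial.eval x (y i)) P :=
    MvPolynomial.dvd_aeval_sub_aeval (R := ℤ_[p]) _ (fun i => by
      convert hG i x using 1
      simp only [y, map_add, map_mul, MvPolynomial.eval_X, MvPolynomial.eval_C]
      ring) P
  convert ((hP (f x)).sub (hP x)).add (hfy.mul_left c) using 1
  rw [compDifference_apply]
  linear_combination c * hQx

theorem IsPadicPolyLimit.compDifference_pow {f : (Fin d → ℤ_[p]) → (Fin d → ℤ_[p])}
    (hf : ∀ i, IsPadicPolyLimit (p : ℤ_[p]) fun x => f x i - x i)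
    {c : ℤ_[p]} {h : (Fin d → ℤ_[p]) → ℤ_[p]} (hh : IsPadicPolyLimit c h) (k : ℕ) :
    IsPadicPolyLimit ((p : ℤ_[p]) ^ k * c) ((_root_.compDifference f ^ k) h) := by
  induction k with
  | zero => simpa using hh
  | succ k ih =>
    rw [pow_succ', pow_succ', mul_assoc]
    exact ih.compDifference hf

theorem PadicInt.add_two_dvd_pow (hp3 : 3 ≤ p) (k : ℕ) :
    ((k + 2 : ℕ) : ℤ_[p]) ∣ (p : ℤ_[p]) ^ k := by
  have hp : p.Prime := Fact.out
  obtain ⟨v, m, hm, hk⟩ := Nat.exists_eq_pow_mul_and_not_dvd (n := k + 2) (by omega) p hp.ne_one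
  have hv : v ≤ k := by
    by_contra! hlt
    have h1 : 3 ^ (k + 1) ≤ k + 2 := calc
      3 ^ (k + 1) ≤ p ^ (k + 1) := Nat.pow_le_pow_left hp3 _
      _ ≤ p ^ v := Nat.pow_le_pow_right hp.pos hlt
      _ ≤ k + 2 := Nat.le_of_dvd (by omega) ⟨m, hk⟩
    have h2 : k < 3 ^ k := Nat.lt_pow_self (by norm_num)
    omega
  have hu : IsUnit (m : ℤ_[p]) := by
    rw [PadicInt.isUnit_iff, PadicInt.norm_natCast_eq_one_iff]
    exact (hp.coprime_iff_not_dvd.2 hm)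
  rw [hk, Nat.cast_mul, Nat.cast_pow, hu.mul_right_dvd]
  exact pow_dvd_pow _ hv

theorem PadicInt.mul_dvd_choose_mul_pow (hp3 : 3 ≤ p) (M k : ℕ) :
    ((M + 1 : ℕ) : ℤ_[p]) * p ∣ ((M + 1).choose (k + 2) : ℤ_[p]) * p ^ (k + 1) := by
  obtain ⟨t, ht⟩ := PadicInt.add_two_dvd_pow hp3 k
  have h := congrArg (Nat.cast (R := ℤ_[p])) (Nat.add_one_mul_choose_eq M (k + 1))
  rw [Nat.cast_mul, Nat.cast_mul] at h
  refine ⟨M.choose (k + 1) * t, ?_⟩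
  rw [pow_succ, ht]
  linear_combination (-(t * p)) * h

theorem one_add_compDifference_pow (f : (Fin d → ℤ_[p]) → (Fin d → ℤ_[p])) (N : ℕ)
    (h : (Fin d → ℤ_[p]) → ℤ_[p]) : ((compDifference f + 1) ^ N) h = h ∘ f^[N] := by
  induction N with
  | zero => rfl
  | succ N ih =>
    rw [pow_succ', Module.End.mul_apply, ih, Function.iterate_succ, compDifference, sub_add_cancel]
    rfl

/-- Periodicity of `f` improves the divisibility of the displacement `h ∘ f - h`. -/
theorem IsPadicPolyLimit.mul_of_iterate_eq_id (hp3 : 3 ≤ p)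
    {f : (Fin d → ℤ_[p]) → (Fin d → ℤ_[p])}
    (hf : ∀ i, IsPadicPolyLimit (p : ℤ_[p]) fun x => f x i - x i)
    {N : ℕ} (hN : 1 ≤ N) (hiter : f^[N] = id) {c : ℤ_[p]} {h : (Fin d → ℤ_[p]) → ℤ_[p]}
    (hh : IsPadicPolyLimit c (_root_.compDifference f h)) :
    IsPadicPolyLimit ((p : ℤ_[p]) * c) (_root_.compDifference f h) := by
  obtain ⟨M, rfl⟩ := Nat.exists_eq_add_of_le' hN
  set Δ := _root_.compDifference f with hΔ
  have hsum : ((M + 1 : ℕ) : ℤ_[p]) • Δ h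
      = -∑ k ∈ Finset.range M, ((M + 1).choose (k + 2) : ℤ_[p]) • (Δ ^ (k + 1)) (Δ h) := by
    have h1 := one_add_compDifference_pow f (M + 1) h
    rw [hiter, Function.comp_id, ← hΔ, (Commute.one_right Δ).add_pow, Finset.sum_range_succ', Finset.sum_range_succ',
      LinearMap.add_apply, LinearMap.add_apply, LinearMap.sum_apply] at h1
    have h2 : ∀ k, (Δ ^ k * 1 ^ (M + 1 - k) *
        ((M + 1).choose k : Module.End ℤ_[p] ((Fin d → ℤ_[p]) → ℤ_[p]))) h
        = ((M + 1).choose k : ℤ_[p]) • (Δ ^ k) h := fun k => by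
      rw [one_pow, mul_one, ← Nat.cast_comm, ← nsmul_eq_mul, LinearMap.smul_apply,
        Nat.cast_smul_eq_nsmul]
    simp only [h2] at h1
    rw [eq_neg_iff_add_eq_zero, add_comm]
    simpa [pow_succ] using h1
  have hN0 : ((M + 1 : ℕ) : ℤ_[p]) ≠ 0 := Nat.cast_ne_zero.2 (by omega)
  refine IsPadicPolyLimit.of_smul hN0 ?_
  rw [hsum]
  refine (IsPadicPolyLimit.sum _ fun k _ => ?_).neg
  refine ((hh.compDifference_pow hf (k + 1)).smul _).of_dvd ?_
  rw [← mul_assoc, ← mul_assoc]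
  exact mul_dvd_mul_right (PadicInt.mul_dvd_choose_mul_pow hp3 M k) c

theorem PadicInt.eq_zero_of_forall_pow_dvd {z : ℤ_[p]} (hz : ∀ n : ℕ, (p : ℤ_[p]) ^ n ∣ z) :
    z = 0 := by
  by_contra h0
  have h := (PadicInt.mem_span_pow_iff_le_valuation z h0 (z.valuation + 1)).1
    (Ideal.mem_span_singleton.2 (hz _))
  omega

theorem IsPadicPolyLimit.eq_zero {h : (Fin d → ℤ_[p]) → ℤ_[p]}
    (hh : ∀ r : ℕ, IsPadicPolyLimit ((p : ℤ_[p]) ^ r) h) (x : Fin d → ℤ_[p]) : h x = 0 := by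
  refine PadicInt.eq_zero_of_forall_pow_dvd fun n => ?_
  obtain ⟨P, hP⟩ := hh n n
  exact (dvd_sub_left (dvd_mul_right _ _)).1 (hP x)

theorem PadicInt.pow_dvd_iff_norm_le {z : ℤ_[p]} {n : ℕ} :
    (p : ℤ_[p]) ^ n ∣ z ↔ ‖z‖ ≤ (p : ℝ) ^ (-n : ℤ) := by
  rw [PadicInt.norm_le_pow_iff_mem_span_pow, Ideal.mem_span_singleton]

/-- A power series with coefficients tending to zero, all congruent to those of `X i` modulo `p`,
differs from the `i`-th coordinate by `p` times a limit of polynomials. -/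
theorem isPadicPolyLimit_tsum_sub (i : Fin d) (a : (Fin d →₀ ℕ) → ℤ_[p])
    (ha : Filter.Tendsto (fun I => ‖a I‖) Filter.cofinite (nhds 0))
    (hcong : ∀ I, ‖a I - (if I = Finsupp.single i 1 then 1 else 0)‖ ≤ (p : ℝ)⁻¹) :
    IsPadicPolyLimit (p : ℤ_[p])
      fun x => (∑' I : Fin d →₀ ℕ, a I * ∏ j : Fin d, x j ^ I j) - x i := fun n => by
  have hp : p.Prime := Fact.out
  choose b hb using fun I => (PadicInt.pow_dvd_iff_norm_le (n := 1)).2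
    (by simpa using hcong I : _ ≤ (p : ℝ) ^ (-(1 : ℕ) : ℤ))
  have hev : ∀ᶠ I in Filter.cofinite, (p : ℤ_[p]) ^ n ∣ a I := by
    have := ha.eventually_lt_const (u := (p : ℝ) ^ (-n : ℤ))
      (zpow_pos (by exact_mod_cast hp.pos) _)
    exact this.mono fun I hI => PadicInt.pow_dvd_iff_norm_le.2 hI.le
  obtain ⟨s, hsingle, hs⟩ : ∃ s : Finset (Fin d →₀ ℕ), Finsupp.single i 1 ∈ s ∧
      ∀ I ∉ s, (p : ℤ_[p]) ^ n ∣ a I := by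
    classical
    refine ⟨insert (Finsupp.single i 1) (Filter.eventually_cofinite.1 hev).toFinset, by simp, ?_⟩
    intro I hI
    by_contra hnot
    exact hI (by simp [hnot])
  refine ⟨∑ I ∈ s, MvPolynomial.monomial I (b I), fun x => ?_⟩
  set m : (Fin d →₀ ℕ) → ℤ_[p] := fun I => ∏ j : Fin d, x j ^ I j with hm
  have hsummable : Summable fun I => a I * m I := by
    refine NonarchimedeanAddGroup.summable_of_tendsto_cofinite_zero ?_
    rw [tendsto_zero_iff_norm_tendsto_zero]
    refine squeeze_zero (fun _ => norm_nonneg _) (fun I => ?_) ha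
    rw [norm_mul]
    exact mul_le_of_le_one_right (norm_nonneg _) (PadicInt.norm_le_one _)
  have hpoly : x i + p * MvPolynomial.eval x (∑ I ∈ s, MvPolynomial.monomial I (b I))
      = ∑ I ∈ s, a I * m I := by
    have hterm : ∀ I, a I * m I
        = (if I = Finsupp.single i 1 then m I else 0) + p * (b I * m I) := fun I => by
      have := hb I
      split_ifs at this ⊢ <;> linear_combination m I * this
    rw [Finset.sum_congr rfl fun I _ => hterm I, Finset.sum_add_distrib, Finset.sum_ite_eq',
      if_pos hsingle, map_sum, Finset.mul_sum]
    congr 1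
    · simp [hm, Finsupp.single_apply, pow_ite]
    · refine Finset.sum_congr rfl fun I _ => ?_
      rw [MvPolynomial.eval_monomial, Finsupp.prod_fintype _ _ (by simp)]
  have htail := hsummable.sum_add_tsum_compl (s := s)
  rw [← hpoly] at htail
  beta_reduce
  rw [← htail]
  convert_to (p : ℤ_[p]) ^ n ∣ ∑' I : ↑((s : Set (Fin d →₀ ℕ))ᶜ), a I * m I
  · ring
  rw [PadicInt.pow_dvd_iff_norm_le]
  refine IsUltrametricDist.norm_tsum_le_of_forall_le_of_nonneg (by positivity) fun I => ?_
  exact PadicInt.pow_dvd_iff_norm_le.1 ((hs I (by exact_mod_cast I.2)).mul_right _)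

end TateDiffeo


/-- **Torsion-freeness of `Diff^an_1(ℤ_p^d)` for `p ≥ 3`.** Let `p ≥ 3` be a prime and let
`f : ℤ_p^d → ℤ_p^d` be a Tate-analytic map with coefficients `a_i(I)` tending to `0`, such
that `f ≡ id mod p`. If some iterate `f^[N]` with `N ≥ 1` is the identity, then `f = id`. -/
theorem tate_diffeo_torsion_free (p : ℕ) [Fact p.Prime] (hp3 : 3 ≤ p)
    (d : ℕ) (hd : 1 ≤ d)
    (a : Fin d → (Fin d →₀ ℕ) → ℤ_[p])
    (ha : ∀ i : Fin d,
      Filter.Tendsto (fun I : Fin d →₀ ℕ => ‖a i I‖) Filter.cofinite (nhds 0))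
    (f : (Fin d → ℤ_[p]) → (Fin d → ℤ_[p]))
    (hf : ∀ (x : Fin d → ℤ_[p]) (i : Fin d),
      f x i = ∑' I : Fin d →₀ ℕ, a i I * ∏ j : Fin d, (x j) ^ (I j))
    (hcong : ∀ (i : Fin d) (I : Fin d →₀ ℕ),
      ‖a i I - (if I = Finsupp.single i 1 then 1 else 0)‖ ≤ (p : ℝ)⁻¹)
    (N : ℕ) (hN : 1 ≤ N) (hiter : f^[N] = id) :
    f = id := by
  have hdiff : ∀ i, IsPadicPolyLimit (p : ℤ_[p]) fun x => f x i - x i := fun i => by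
    simpa only [hf] using isPadicPolyLimit_tsum_sub i (a i) (ha i) (hcong i)
  funext x i
  refine sub_eq_zero.1 (IsPadicPolyLimit.eq_zero (h := compDifference f fun x => x i) ?_ x)
  intro r
  induction r with
  | zero => exact (hdiff i).of_dvd (by simp)
  | succ r ih =>
    rw [pow_succ']
    exact ih.mul_of_iterate_eq_id hp3 hdiff hN hiter
end

section
/- Let d ≥ 1 and let Φ : ℤ_p → (ℤ_p^d → ℤ_p^d) satisfy: Φ_0 = id; Φ_{s+t} = Φ_s ∘ Φ_t for all s,t ∈ ℤ_p; and Φ_t → id uniformly as t → 0, i.e., for every ε > 0 there exists δ > 0 such that for all t with ‖t‖ ≤ δ and all x ∈ ℤ_p^d, ‖Φ_t(x) − x‖ ≤ ε. Then for every clopen subset U of ℤ_p^d there exists ε > 0 such that for all t ∈ ℤ_p with ‖t‖ ≤ ε, the image Φ_t(U) equals U. -/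
/-- **Clopen sets are stable under small times of a flow.** Let `Φ : ℤ_p → (ℤ_p^d → ℤ_p^d)`
satisfy `Φ_0 = id`, `Φ_{s+t} = Φ_s ∘ Φ_t`, and `Φ_t → id` uniformly as `t → 0`. Then for every
clopen `U ⊆ ℤ_p^d` there is `ε > 0` such that `Φ_t(U) = U` whenever `‖t‖ ≤ ε`. -/
theorem flow_preserves_clopen (p : ℕ) [Fact p.Prime] (d : ℕ) (hd : 1 ≤ d)
    (Φ : ℤ_[p] → (Fin d → ℤ_[p]) → (Fin d → ℤ_[p]))
    (h0 : Φ 0 = id)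
    (hadd : ∀ s t : ℤ_[p], Φ (s + t) = Φ s ∘ Φ t)
    (hcont : ∀ ε : ℝ, 0 < ε → ∃ δ : ℝ, 0 < δ ∧
      ∀ t : ℤ_[p], ‖t‖ ≤ δ → ∀ x : Fin d → ℤ_[p], ‖Φ t x - x‖ ≤ ε)
    (U : Set (Fin d → ℤ_[p])) (hU : IsClopen U) :
    ∃ ε : ℝ, 0 < ε ∧ ∀ t : ℤ_[p], ‖t‖ ≤ ε → Φ t '' U = U := by
  obtain ⟨r, hr, hrU⟩ := hU.1.isCompact.exists_thickening_subset_open hU.2 subset_rfl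
  obtain ⟨δ, hδ, hΦ⟩ := hcont (r / 2) (half_pos hr)
  have maps : ∀ t : ℤ_[p], ‖t‖ ≤ δ → ∀ x ∈ U, Φ t x ∈ U := fun t ht x hx =>
    hrU (Metric.mem_thickening_iff.2
      ⟨x, hx, by rw [dist_eq_norm]; exact (hΦ t ht x).trans_lt (half_lt_self hr)⟩)
  refine ⟨δ, hδ, fun t ht => Set.Subset.antisymm ?_ fun y hy => ?_⟩
  · rintro _ ⟨x, hx, rfl⟩
    exact maps t ht x hx
  · refine ⟨Φ (-t) y, maps (-t) (by rwa [norm_neg]) y hy, ?_⟩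
    rw [← Function.comp_apply (f := Φ t), ← hadd, add_neg_cancel, h0, id]
end

section
/- Let H be a nilpotent group generated by a finite set {h_1,…,h_s}. Then for every integer m ≥ 1, the subgroup of H generated by {h_1^m,…,h_s^m} has finite index in H. -/
open Subgroup in
/-- In a finitely generated group, a subgroup containing the commutator subgroup and a positive
power of each element of a generating set has finite index. -/
theorem Subgroup.finiteIndex_of_commutator_le {G : Type*} [Group G] [Group.FG G] {K : Subgroup G}
    (hK : _root_.commutator G ≤ K) {S : Set G} (hS : closure S = ⊤)
    (hpow : ∀ g ∈ S, ∃ n : ℕ, 0 < n ∧ g ^ n ∈ K) : K.FiniteIndex := by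
  have : K.Normal := Normal.of_commutator_le G hK
  have hcomm : IsMulCommutative (G ⧸ K) := Normal.quotient_commutative_iff_commutator_le.mpr hK
  let : CommGroup (G ⧸ K) := { mul_comm := hcomm.is_comm.comm }
  have htors (g : G) : IsOfFinOrder (g : G ⧸ K) := by
    have hg : g ∈ closure S := hS ▸ mem_top g
    induction hg using closure_induction with
    | mem x hx =>
      obtain ⟨n, hn, hxn⟩ := hpow x hx
      exact isOfFinOrder_iff_pow_eq_one.mpr
        ⟨n, hn, by rwa [← QuotientGroup.mk_pow, QuotientGroup.eq_one_iff]⟩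
    | one => exact IsOfFinOrder.one
    | mul x y _ _ hx hy => exact hx.mul hy
    | inv x _ hx => exact hx.inv
  have : Finite (G ⧸ K) := CommGroup.finite_of_fg_isMulTorsion (G ⧸ K)
    fun q => QuotientGroup.induction_on q htors
  exact finiteIndex_of_finite_quotient

open Subgroup in
open scoped commutatorElement in
/-- If `A` is central, contained in the commutator subgroup, and `K ⊔ A` has finite index in a
finitely generated group, then so does `K`. -/
theorem Subgroup.finiteIndex_of_finiteIndex_sup_of_le_center {G : Type*} [Group G] [Group.FG G]
    {K A : Subgroup G} (hcenter : A ≤ center G) (hcomm : A ≤ _root_.commutator G)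
    [(K ⊔ A).FiniteIndex] : K.FiniteIndex := by
  have hA (a : G) (ha : a ∈ A) (g : G) : g * a = a * g := mem_center_iff.mp (hcenter ha) g
  have : A.Normal := ⟨fun a ha g => by rwa [hA a ha, mul_inv_cancel_right]⟩
  have hKA : _root_.commutator ↥(K ⊔ A) ≤ K.subgroupOf (K ⊔ A) := by
    refine commutator_le.mpr fun x _ y _ => ?_
    obtain ⟨k, hk, a, ha, hx⟩ := mem_sup_of_normal_right.mp x.2
    obtain ⟨l, hl, b, hb, hy⟩ := mem_sup_of_normal_right.mp y.2
    have hxy : ⁅k * a, l * b⁆ = ⁅k, l⁆ := by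
      calc ⁅k * a, l * b⁆ = k * (a * (l * b)) * a⁻¹ * k⁻¹ * b⁻¹ * l⁻¹ := by
            rw [commutatorElement_def]; group
        _ = k * l * (b * k⁻¹) * b⁻¹ * l⁻¹ := by rw [← hA a ha]; group
        _ = ⁅k, l⁆ := by rw [← hA b hb, commutatorElement_def]; group
    change ⁅(x : G), (y : G)⁆ ∈ K
    rw [← hx, ← hy, hxy, commutatorElement_def]
    exact K.mul_mem (K.mul_mem (K.mul_mem hk hl) (K.inv_mem hk)) (K.inv_mem hl)
  have hpow (a : G) (ha : a ∈ A) : a ^ (K ⊔ A).index ∈ K := by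
    have hker : a ∈ (MonoidHom.transfer (Abelianization.of (G := ↥(K ⊔ A)))).ker :=
      Abelianization.commutator_subset_ker _ (hcomm ha)
    rw [MonoidHom.mem_ker, MonoidHom.transfer_eq_pow _ a fun k g _ => by
      rw [mul_assoc, ← hA _ (A.pow_mem ha k), inv_mul_cancel_left], ← MonoidHom.mem_ker,
      Abelianization.ker_of] at hker
    exact hKA hker
  have hfin : (K.subgroupOf (K ⊔ A)).FiniteIndex := by
    refine finiteIndex_of_commutator_le hKA
      (S := (K.subgroupOf (K ⊔ A) : Set ↥(K ⊔ A)) ∪ A.subgroupOf (K ⊔ A)) ?_ ?_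
    · rw [closure_union, closure_eq, closure_eq, ← subgroupOf_sup le_sup_left le_sup_right,
        subgroupOf_self]
    · rintro x (hx | hx)
      · exact ⟨1, one_pos, by rwa [pow_one]⟩
      · exact ⟨_, Nat.pos_of_ne_zero FiniteIndex.index_ne_zero, hpow x hx⟩
  refine ⟨?_⟩
  rw [← relIndex_mul_index (le_sup_left : K ≤ K ⊔ A)]
  exact mul_ne_zero hfin.index_ne_zero FiniteIndex.index_ne_zero

open Subgroup in
/-- In a finitely generated group with vanishing lower central series, a subgroup containing a
positive power of each element of a generating set has finite index. -/
theorem Subgroup.finiteIndex_of_lowerCentralSeries_eq_bot (n : ℕ) {G : Type*} [Group G]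
    [Group.FG G] (hn : (⊤ : Subgroup G).lowerCentralSeries (n + 1) = ⊥) {K : Subgroup G}
    {S : Set G} (hS : closure S = ⊤) (hpow : ∀ g ∈ S, ∃ n : ℕ, 0 < n ∧ g ^ n ∈ K) :
    K.FiniteIndex := by
  induction n generalizing G with
  | zero =>
    rw [zero_add, top_lowerCentralSeries_one] at hn
    exact finiteIndex_of_commutator_le (hn ▸ bot_le) hS hpow
  | succ n ih =>
    let A := (⊤ : Subgroup G).lowerCentralSeries (n + 1)
    have hcenter : A ≤ center G := by
      rwa [lowerCentralSeries_succ, commutator_eq_bot_iff_le_centralizer, coe_top,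
        centralizer_univ] at hn
    have hcomm : A ≤ _root_.commutator G :=
      lowerCentralSeries_antitone ⊤ (Nat.le_add_left 1 n)
    have hsurj := QuotientGroup.mk'_surjective A
    have hmap : (K.map (QuotientGroup.mk' A)).FiniteIndex := by
      refine ih (S := Set.image (QuotientGroup.mk' A) S) ?_ ?_ ?_
      · rw [← map_top_of_surjective _ hsurj, ← map_lowerCentralSeries, map_eq_bot_iff,
          QuotientGroup.ker_mk']
      · rw [← MonoidHom.map_closure, hS, map_top_of_surjective _ hsurj]
      · rintro _ ⟨g, hg, rfl⟩
        obtain ⟨k, hk, hgk⟩ := hpow g hg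
        exact ⟨k, hk, map_pow (QuotientGroup.mk' A) g k ▸ mem_map_of_mem _ hgk⟩
    have : (K ⊔ A).FiniteIndex := by
      refine ⟨?_⟩
      have h := hmap.index_ne_zero
      rw [index_map, QuotientGroup.ker_mk'] at h
      exact left_ne_zero_of_mul h
    exact finiteIndex_of_finiteIndex_sup_of_le_center hcenter hcomm

/-- Let `H` be a nilpotent group generated by finitely many elements `h₁, …, h_s`. Then for
every `m ≥ 1`, the subgroup generated by `h₁^m, …, h_s^m` has finite index in `H`. -/
theorem finiteIndex_closure_powers (H : Type*) [Group H] [Group.IsNilpotent H]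
    (s : ℕ) (h : Fin s → H) (hgen : Subgroup.closure (Set.range h) = ⊤)
    (m : ℕ) (hm : 1 ≤ m) :
    (Subgroup.closure (Set.range fun i => h i ^ m)).FiniteIndex := by
  have : Group.FG H := Group.fg_iff.mpr ⟨_, hgen, Set.finite_range h⟩
  obtain ⟨n, hn⟩ := Subgroup.nilpotent_iff_lowerCentralSeries.mp ‹Group.IsNilpotent H›
  refine Subgroup.finiteIndex_of_lowerCentralSeries_eq_bot n ?_ hgen ?_
  · exact eq_bot_mono (Subgroup.lowerCentralSeries_antitone ⊤ n.le_succ) hn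
  · rintro _ ⟨i, rfl⟩
    exact ⟨m, hm, Subgroup.subset_closure ⟨i, rfl⟩⟩
end

section
/- Let n ≥ 1 and let G be a subgroup of GL_n(ℤ) all of whose elements are upper triangular with 1's on the diagonal (for every A ∈ G: A_{ii} = 1 for all i, and A_{ij} = 0 whenever i > j). Then for a subgroup K of G, the following are equivalent: (1) K has finite index in G; (2) there exists an integer m ≥ 1 such that K contains every A ∈ G congruent to the identity matrix modulo m (i.e., m divides A_{ij} − δ_{ij} for all i,j). In other words, the profinite topology and the adelic (congruence) topology on G coincide. -/
open Matrix

/-- If `K` has finite index and contains the kernel of an integer-valued homomorphism on `H`, then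
`K` contains the elements of `H` whose value is divisible by a suitable positive integer. -/
theorem Subgroup.FiniteIndex.exists_dvd_imp_mem {G : Type*} [Group G] {H K : Subgroup G}
    [K.FiniteIndex] (φ : H →* Multiplicative ℤ) (hφ : ∀ h, φ h = 1 → (h : G) ∈ K) :
    ∃ q : ℕ, 1 ≤ q ∧ ∀ h : H, (q : ℤ) ∣ (φ h).toAdd → (h : G) ∈ K := by
  by_cases hK : ∀ k : H, (k : G) ∈ K → φ k = 1
  · refine ⟨1, le_rfl, fun h _ ↦ hφ h ?_⟩
    obtain ⟨N, hN, -, hmem⟩ := Subgroup.exists_pow_mem_of_index_ne_zero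
      (Subgroup.FiniteIndex.index_ne_zero (H := K)) (h : G)
    have h1 := congrArg Multiplicative.toAdd (hK (h ^ N) hmem)
    rw [map_pow, toAdd_pow, toAdd_one, smul_eq_zero] at h1
    exact toAdd_eq_zero.mp (h1.resolve_left hN.ne')
  · push Not at hK
    obtain ⟨k, hk, hne⟩ := hK
    refine ⟨(φ k).toAdd.natAbs, ?_, fun h hdvd ↦ ?_⟩
    · exact Int.natAbs_pos.mpr fun h0 ↦ hne (toAdd_eq_zero.mp h0)
    · obtain ⟨b, hb⟩ := Int.natAbs_dvd.mp hdvd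
      have hmem : ((h * (k ^ b)⁻¹ : H) : G) ∈ K := by
        refine hφ _ (toAdd_eq_zero.mp ?_)
        rw [map_mul, map_inv, map_zpow, toAdd_mul, toAdd_inv, toAdd_zpow, hb, smul_eq_mul]
        ring
      have hmul := K.mul_mem hmem (K.zpow_mem hk b)
      rwa [Subgroup.coe_mul, Subgroup.coe_inv, Subgroup.coe_zpow, inv_mul_cancel_right] at hmul

/-- A finite-index subgroup containing a normal subgroup `H` contains a member of the family `Γ`
as soon as this holds for all finite-index subgroups containing a larger normal subgroup `H'`, and
the trace of `Γ` on `H'` is fine enough. -/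
theorem Subgroup.exists_le_of_exists_inf_le {G : Type*} [Group G] {H' K : Subgroup G} [H'.Normal]
    [K.FiniteIndex] (Γ : ℕ → Subgroup G) (hΓ : ∀ a b, Γ (a * b) ≤ Γ a)
    (hfin : ∀ m, 1 ≤ m → (Γ m).FiniteIndex)
    (hH' : ∀ L : Subgroup G, L.FiniteIndex → H' ≤ L → ∃ m, 1 ≤ m ∧ Γ m ≤ L)
    (hK : ∃ q, 1 ≤ q ∧ Γ q ⊓ H' ≤ K) : ∃ m, 1 ≤ m ∧ Γ m ≤ K := by
  obtain ⟨q, hq, hqK⟩ := hK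
  have := hfin q hq
  obtain ⟨m, hm, hmL⟩ := hH' ((Γ q ⊓ K) ⊔ H') (Subgroup.finiteIndex_of_le le_sup_left) le_sup_right
  refine ⟨m * q, Nat.mul_pos hm hq, fun g hg ↦ ?_⟩
  obtain ⟨k, ⟨hkΓ, hkK⟩, z, hz, rfl⟩ := Subgroup.mem_sup_of_normal_right.mp (hmL (hΓ m q hg))
  have hgq : k * z ∈ Γ q := hΓ q m (mul_comm m q ▸ hg)
  exact K.mul_mem hkK (hqK ⟨((Γ q).mul_mem_cancel_left hkΓ).mp hgq, hz⟩)

/-- The position of the entry `(i, j)` when the columns are read from left to right, and each column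
from bottom to top. -/
def Matrix.entryRank {n : ℕ} (i j : Fin n) : ℕ := (finProdFinEquiv (j, i.rev) : Fin (n * n))

namespace Matrix

variable {n : ℕ}

theorem entryRank_lt (i j : Fin n) : entryRank i j < n * n := Fin.is_lt _

theorem exists_entryRank_eq {t : ℕ} (ht : t < n * n) :
    ∃ i₀ j₀ : Fin n, ∀ i j, entryRank i j = t ↔ i = i₀ ∧ j = j₀ := by
  obtain ⟨⟨j₀, i₀⟩, h⟩ := finProdFinEquiv.surjective (⟨t, ht⟩ : Fin (n * n))
  refine ⟨i₀.rev, j₀, fun i j ↦ ?_⟩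
  have : entryRank i j = t ↔ (j, i.rev) = (j₀, i₀) := by
    rw [← finProdFinEquiv.injective.eq_iff, h, Fin.ext_iff, entryRank]
  rw [this, Prod.mk.injEq, Fin.rev_eq_iff]
  exact and_comm

theorem entryRank_lt_of_col_lt (i : Fin n) {k j : Fin n} (h : k < j) :
    entryRank i k < entryRank i j := by
  have : 0 < n := i.pos
  simp only [entryRank, finProdFinEquiv_apply_val]
  gcongr
  exact h

theorem entryRank_le_of_row_le {i k : Fin n} (j : Fin n) (h : i ≤ k) :
    entryRank k j ≤ entryRank i j := by
  simp only [entryRank, finProdFinEquiv_apply_val]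
  gcongr
  exact Fin.rev_le_rev.mpr h

/-- The first `t` entries of `X`, in the order given by `entryRank`, vanish. -/
def VanishesBelow (t : ℕ) (X : Matrix (Fin n) (Fin n) ℤ) : Prop :=
  ∀ i j, entryRank i j < t → X i j = 0

namespace VanishesBelow

variable {t : ℕ} {X Y B : Matrix (Fin n) (Fin n) ℤ}

theorem add (hX : VanishesBelow t X) (hY : VanishesBelow t Y) : VanishesBelow t (X + Y) :=
  fun i j h ↦ by rw [add_apply, hX i j h, hY i j h, add_zero]

theorem neg (hX : VanishesBelow t X) : VanishesBelow t (-X) :=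
  fun i j h ↦ by rw [neg_apply, hX i j h, neg_zero]

theorem mul_right (hX : VanishesBelow t X) (hB : B.IsUpperTriangular) :
    VanishesBelow t (X * B) := fun i j h ↦ by
  rw [mul_apply]
  refine Finset.sum_eq_zero fun k _ ↦ ?_
  rcases lt_trichotomy k j with hk | rfl | hk
  · rw [hX i k ((entryRank_lt_of_col_lt i hk).trans h), zero_mul]
  · rw [hX i k h, zero_mul]
  · rw [hB hk, mul_zero]

theorem mul_left (hX : VanishesBelow t X) (hB : B.IsUpperTriangular) :
    VanishesBelow t (B * X) := fun i j h ↦ by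
  rw [mul_apply]
  refine Finset.sum_eq_zero fun k _ ↦ ?_
  rcases lt_or_ge k i with hk | hk
  · rw [hB hk, zero_mul]
  · rw [hX k j ((entryRank_le_of_row_le j hk).trans_lt h), mul_zero]

theorem mul_strictUpper (hX : VanishesBelow t X) (hY : ∀ i j, j ≤ i → Y i j = 0) :
    VanishesBelow (t + 1) (X * Y) := fun i j h ↦ by
  rw [mul_apply]
  refine Finset.sum_eq_zero fun k _ ↦ ?_
  rcases lt_or_ge k j with hk | hk
  · rw [hX i k ((entryRank_lt_of_col_lt i hk).trans_le (Nat.lt_succ_iff.mp h)), zero_mul]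
  · rw [hY k j hk, mul_zero]

end VanishesBelow

/-- Every element of `G` is upper triangular with ones on the diagonal. -/
def IsUnitriangularSubgroup (G : Subgroup (GL (Fin n) ℤ)) : Prop :=
  ∀ A ∈ G, (∀ i : Fin n, (A : Matrix (Fin n) (Fin n) ℤ) i i = 1) ∧
    ∀ i j : Fin n, j < i → (A : Matrix (Fin n) (Fin n) ℤ) i j = 0

namespace IsUnitriangularSubgroup

variable {G : Subgroup (GL (Fin n) ℤ)}

theorem isUpperTriangular (hG : IsUnitriangularSubgroup G) (A : G) :
    (A.1.1).IsUpperTriangular := fun _ _ h ↦ (hG A A.2).2 _ _ h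

theorem sub_one_apply_eq_zero (hG : IsUnitriangularSubgroup G) (A : G) (i j : Fin n) (h : j ≤ i) :
    (A.1.1 - 1) i j = 0 := by
  rcases h.lt_or_eq with h | rfl
  · rw [sub_apply, one_apply_ne h.ne', (hG A A.2).2 i j h, sub_zero]
  · rw [sub_apply, one_apply_eq, (hG A A.2).1, sub_self]

/-- The elements of a unitriangular group whose first `t` entries, in the order given by
`entryRank`, are those of the identity. -/
def filtration (hG : IsUnitriangularSubgroup G) (t : ℕ) : Subgroup G where
  carrier := {A | VanishesBelow t (A.1.1 - 1)}
  one_mem' := fun i j _ ↦ by simp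
  mul_mem' := fun {A B} hA hB ↦ by
    have h : (A * B).1.1 - 1 = (A.1.1 - 1) * B.1.1 + (B.1.1 - 1) := by
      rw [sub_mul, one_mul, sub_add_sub_cancel]; rfl
    rw [Set.mem_ofPred_eq, h]
    exact (hA.mul_right (hG.isUpperTriangular B)).add hB
  inv_mem' := fun {A} hA ↦ by
    have h : (A⁻¹).1.1 - 1 = -((A⁻¹).1.1 * (A.1.1 - 1)) := by
      have : (A⁻¹).1.1 * A.1.1 = 1 := A.1.inv_mul
      rw [mul_sub, this, mul_one, neg_sub]
    rw [Set.mem_ofPred_eq, h]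
    exact (hA.mul_left (hG.isUpperTriangular A⁻¹)).neg

theorem mem_filtration (hG : IsUnitriangularSubgroup G) {t : ℕ} {A : G} :
    A ∈ hG.filtration t ↔ VanishesBelow t (A.1.1 - 1) := Iff.rfl

instance (hG : IsUnitriangularSubgroup G) (t : ℕ) : (hG.filtration t).Normal where
  conj_mem A hA B := by
    have h : (B * A * B⁻¹).1.1 - 1 = B.1.1 * (A.1.1 - 1) * (B⁻¹).1.1 := by
      have : B.1.1 * (B⁻¹).1.1 = 1 := B.1.mul_inv
      rw [mul_sub, sub_mul, mul_one, this]; rfl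
    rw [mem_filtration, h]
    exact (VanishesBelow.mul_left hA (hG.isUpperTriangular B)).mul_right (hG.isUpperTriangular B⁻¹)

theorem filtration_zero (hG : IsUnitriangularSubgroup G) : hG.filtration 0 = ⊤ :=
  eq_top_iff.mpr fun _ _ _ _ h ↦ absurd h (Nat.not_lt_zero _)

theorem filtration_mul_self (hG : IsUnitriangularSubgroup G) : hG.filtration (n * n) = ⊥ := by
  refine (Subgroup.eq_bot_iff_forall _).mpr fun A hA ↦ Subtype.ext (Units.ext ?_)
  exact sub_eq_zero.mp (Matrix.ext fun i j ↦ hA i j (entryRank_lt i j))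

/-- The `(i, j)` entry as a homomorphism on the filtration step in which all earlier entries are those
of the identity. -/
def entryHom (hG : IsUnitriangularSubgroup G) (i j : Fin n) :
    hG.filtration (entryRank i j) →* Multiplicative ℤ where
  toFun A := .ofAdd ((A.1.1.1 - 1) i j)
  map_one' := by simp
  map_mul' A B := by
    have h : (A * B).1.1.1 - 1 =
        (A.1.1.1 - 1) + (B.1.1.1 - 1) + (A.1.1.1 - 1) * (B.1.1.1 - 1) := by
      change A.1.1.1 * B.1.1.1 - 1 = _
      noncomm_ring
    rw [h, add_apply, VanishesBelow.mul_strictUpper A.2 (hG.sub_one_apply_eq_zero B.1) i j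
      (Nat.lt_succ_self _), add_zero, add_apply, ofAdd_add]

theorem mem_filtration_succ (hG : IsUnitriangularSubgroup G) {i j : Fin n}
    (A : hG.filtration (entryRank i j)) (hA : hG.entryHom i j A = 1) :
    (A : G) ∈ hG.filtration (entryRank i j + 1) := by
  intro k l h
  rcases (Nat.lt_succ_iff.mp h).lt_or_eq with h | h
  · exact A.2 k l h
  · obtain ⟨i₀, j₀, h₀⟩ := exists_entryRank_eq (entryRank_lt i j)
    obtain ⟨rfl, rfl⟩ := (h₀ i j).mp rfl
    obtain ⟨rfl, rfl⟩ := (h₀ k l).mp h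
    exact ofAdd_eq_one.mp hA

end IsUnitriangularSubgroup

/-- The elements of `G` congruent to the identity modulo `m`. -/
def congruenceSubgroup (G : Subgroup (GL (Fin n) ℤ)) (m : ℕ) : Subgroup G :=
  ((GeneralLinearGroup.map (Int.castRingHom (ZMod m))).comp G.subtype).ker

theorem mem_congruenceSubgroup {G : Subgroup (GL (Fin n) ℤ)} {m : ℕ} {A : G} :
    A ∈ congruenceSubgroup G m ↔
      ∀ i j, (m : ℤ) ∣ A.1.1 i j - (1 : Matrix (Fin n) (Fin n) ℤ) i j := by
  rw [congruenceSubgroup, MonoidHom.mem_ker, Units.ext_iff, ← Matrix.ext_iff]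
  refine forall₂_congr fun i j ↦ ?_
  rw [← ZMod.intCast_zmod_eq_zero_iff_dvd, Int.cast_sub, sub_eq_zero]
  have h1 : (((1 : Matrix (Fin n) (Fin n) ℤ) i j : ℤ) : ZMod m) =
      (1 : Matrix (Fin n) (Fin n) (ZMod m)) i j := by
    rw [one_apply, one_apply]; split_ifs <;> simp
  rw [h1]
  rfl

theorem congruenceSubgroup_mul_le (G : Subgroup (GL (Fin n) ℤ)) (a b : ℕ) :
    congruenceSubgroup G (a * b) ≤ congruenceSubgroup G a := fun A hA ↦ by
  rw [mem_congruenceSubgroup] at hA ⊢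
  exact fun i j ↦ (Int.natCast_dvd_natCast.mpr (dvd_mul_right a b)).trans (hA i j)

theorem finiteIndex_congruenceSubgroup (G : Subgroup (GL (Fin n) ℤ)) {m : ℕ} (hm : 1 ≤ m) :
    (congruenceSubgroup G m).FiniteIndex := by
  have : NeZero m := ⟨Nat.one_le_iff_ne_zero.mp hm⟩
  exact Subgroup.finiteIndex_ker _

/-- A finite-index subgroup of a unitriangular group over `ℤ` that contains a step of the filtration
contains a congruence subgroup. -/
theorem IsUnitriangularSubgroup.exists_congruenceSubgroup_le {G : Subgroup (GL (Fin n) ℤ)}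
    (hG : IsUnitriangularSubgroup G) {t : ℕ} (ht : t ≤ n * n) (K : Subgroup G)
    (hfin : K.FiniteIndex) (hK : hG.filtration t ≤ K) :
    ∃ m, 1 ≤ m ∧ congruenceSubgroup G m ≤ K := by
  induction t generalizing K with
  | zero => exact ⟨1, le_rfl, le_top.trans (hG.filtration_zero ▸ hK)⟩
  | succ t ih =>
    obtain ⟨i, j, h⟩ := exists_entryRank_eq ht
    obtain rfl : entryRank i j = t := (h i j).mpr ⟨rfl, rfl⟩
    refine Subgroup.exists_le_of_exists_inf_le _ (congruenceSubgroup_mul_le G)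
      (fun m ↦ finiteIndex_congruenceSubgroup G) (ih (Nat.le_of_succ_le ht)) ?_
    obtain ⟨q, hq, hqK⟩ := Subgroup.FiniteIndex.exists_dvd_imp_mem (K := K) (hG.entryHom i j)
      fun A hA ↦ hK (hG.mem_filtration_succ A hA)
    exact ⟨q, hq, fun A hA ↦ hqK ⟨A, hA.2⟩ (mem_congruenceSubgroup.mp hA.1 i j)⟩

end Matrix


/-- Let `G` be a subgroup of `GL_n(ℤ)` all of whose elements are upper triangular with `1`'s
on the diagonal. For a subgroup `K` of `G`, `K` has finite index in `G` if and only if there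
is `m ≥ 1` such that `K` contains every element of `G` congruent to the identity modulo `m`:
the profinite and adelic (congruence) topologies on `G` coincide. -/
theorem unitriangular_profinite_eq_adelic (n : ℕ) (hn : 1 ≤ n)
    (G : Subgroup (GL (Fin n) ℤ))
    (hG : ∀ A ∈ G, (∀ i : Fin n, (A : Matrix (Fin n) (Fin n) ℤ) i i = 1) ∧
      ∀ i j : Fin n, j < i → (A : Matrix (Fin n) (Fin n) ℤ) i j = 0)
    (K : Subgroup G) :
    K.FiniteIndex ↔ ∃ m : ℕ, 1 ≤ m ∧ ∀ A : G,
      (∀ i j : Fin n, (m : ℤ) ∣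
          ((A : GL (Fin n) ℤ) : Matrix (Fin n) (Fin n) ℤ) i j -
            (1 : Matrix (Fin n) (Fin n) ℤ) i j) →
        A ∈ K := by
  constructor
  · intro hK
    have hU : IsUnitriangularSubgroup G := hG
    obtain ⟨m, hm, hle⟩ := hU.exists_congruenceSubgroup_le le_rfl K hK
      (hU.filtration_mul_self.trans_le bot_le)
    exact ⟨m, hm, fun A hA ↦ hle (mem_congruenceSubgroup.mpr hA)⟩
  · rintro ⟨m, hm, h⟩
    have := finiteIndex_congruenceSubgroup G hm
    exact Subgroup.finiteIndex_of_le fun A hA ↦ h A (mem_congruenceSubgroup.mp hA)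
end

section
/- Let k be a field of characteristic zero, let A be an integral domain that is a finitely generated k-algebra with Krull dimension d, and let H be a finitely generated nilpotent group acting faithfully on Spec A by k-algebra automorphisms, i.e., there is an injective group homomorphism H → Aut_k(A) into the group of k-algebra automorphisms of A. Then the virtual derived length of H is at most d: there exists a finite-index subgroup H₀ of H whose derived series terminates after at most d steps (the d-th term of the derived series of H₀ is trivial). -/
section Core

variable {H E : Type*} [Group H] [Field E]

/-- Conjugation of a self-map of `E` by a field automorphism. -/
def conjMap (g : E ≃+* E) (φ : E → E) : E → E := fun x => g (φ (g.symm x))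

lemma conjMap_add (g : E ≃+* E) (φ ψ : E → E) :
    conjMap g (φ + ψ) = conjMap g φ + conjMap g ψ := by
  ext x; simp [conjMap]

lemma conjMap_sub (g : E ≃+* E) (φ ψ : E → E) :
    conjMap g (φ - ψ) = conjMap g φ - conjMap g ψ := by
  ext x; simp [conjMap]

lemma conjMap_smul (g : E ≃+* E) (c : E) (φ : E → E) :
    conjMap g (c • φ) = g c • conjMap g φ := by
  ext x; simp [conjMap]

lemma conjMap_zero (g : E ≃+* E) : conjMap g (0 : E → E) = 0 := by
  ext x; simp [conjMap]

lemma conjMap_sum (g : E ≃+* E) {ι : Type*} (s : Finset ι) (φ : ι → E → E) :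
    conjMap g (∑ i ∈ s, φ i) = ∑ i ∈ s, conjMap g (φ i) := by
  classical
  induction s using Finset.induction_on with
  | empty => simp [conjMap_zero]
  | insert a s ha ih => rw [Finset.sum_insert ha, Finset.sum_insert ha, conjMap_add, ih]

/-- The formal properties of the logarithm `D h` of a group of field automorphisms `σ h`
that are used to bound derived lengths. -/
structure IsLogarithm (σ : H →* (E ≃+* E)) (D : H → E → E) : Prop where
  conj : ∀ g h, D (g * h * g⁻¹) = conjMap (σ g) (D h)
  fix : ∀ h x, D h x = 0 ↔ σ h x = x
  log_mul : ∀ (M : Subgroup H), M.Normal → ∀ a b, a * b * a⁻¹ * b⁻¹ ∈ M →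
    D (a * b) - D a - D b ∈ Submodule.span E (D '' (M : Set H))

/-- The span of the logarithms of the elements of a subgroup. -/
def logSpan (D : H → E → E) (M : Subgroup H) : Submodule E (E → E) :=
  Submodule.span E (D '' (M : Set H))

/-- A normal subgroup that contains every element whose logarithm lies in its span. -/
def IsLogClosed (D : H → E → E) (M : Subgroup H) : Prop :=
  M.Normal ∧ ∀ h, D h ∈ logSpan D M → h ∈ M

variable {σ : H →* (E ≃+* E)} {D : H → E → E}

lemma mem_logSpan {M : Subgroup H} {h : H} (hh : h ∈ M) : D h ∈ logSpan D M :=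
  Submodule.subset_span ⟨h, hh, rfl⟩

lemma logSpan_mono {M N : Subgroup H} (h : M ≤ N) : logSpan D M ≤ logSpan D N :=
  Submodule.span_mono (Set.image_mono h)

namespace IsLogarithm

lemma conjMap_mem_logSpan (hD : IsLogarithm σ D) {M : Subgroup H} (hM : M.Normal) (g : H)
    {φ : E → E} (hφ : φ ∈ logSpan D M) : conjMap (σ g) φ ∈ logSpan D M := by
  induction hφ using Submodule.span_induction with
  | mem x hx =>
    obtain ⟨h, hh, rfl⟩ := hx
    rw [← hD.conj]
    exact mem_logSpan (hM.conj_mem h hh g)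
  | zero => rw [conjMap_zero]; exact zero_mem _
  | add x y _ _ hx hy => rw [conjMap_add]; exact add_mem hx hy
  | smul a x _ hx => rw [conjMap_smul]; exact Submodule.smul_mem _ _ hx

lemma map_one (hD : IsLogarithm σ D) : D 1 = 0 := by
  ext x
  exact (hD.fix 1 x).2 (by simp)

lemma mul_left_sub_mem (hD : IsLogarithm σ D) {M : Subgroup H} (hM : M.Normal) {c : H}
    (hc : c ∈ M) (h : H) : D (c * h) - D h ∈ logSpan D M := by
  have h1 : c * h * c⁻¹ * h⁻¹ ∈ M := by
    have := M.mul_mem hc (hM.conj_mem _ (M.inv_mem hc) h)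
    simpa [mul_assoc] using this
  have h2 := hD.log_mul M hM c h h1
  have h3 : _ ∈ logSpan D M := add_mem h2 (mem_logSpan (D := D) hc)
  rwa [sub_right_comm, sub_add_cancel] at h3

/-- The key step: a proper log-closed subgroup `M` of a nilpotent group is contained in a
log-closed subgroup of larger rank which is abelian modulo `M`. -/
lemma exists_logClosed [Group.IsNilpotent H] (hD : IsLogarithm σ D) {M : Subgroup H}
    (hM : IsLogClosed D M) (hne : M ≠ ⊤) :
    ∃ M' : Subgroup H, IsLogClosed D M' ∧ logSpan D M < logSpan D M' ∧ ⁅M', M'⁆ ≤ M := by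
  classical
  obtain ⟨hMn, hMc⟩ := hM
  set W := logSpan D M
  let Z : Subgroup H := (Subgroup.center (H ⧸ M)).comap (QuotientGroup.mk' M)
  have hZn : Z.Normal := inferInstanceAs (Subgroup.Normal (Subgroup.comap _ _))
  have hZ : ∀ z ∈ Z, ∀ h : H, h * z * h⁻¹ * z⁻¹ ∈ M := by
    intro z hz h
    rw [← QuotientGroup.eq_one_iff]
    have := (Subgroup.mem_center_iff.1 (Subgroup.mem_comap.1 hz)) (h : H ⧸ M)
    simp only [QuotientGroup.mk'_apply] at this
    simp [this]
  have hMZ : M ≤ Z := by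
    intro m hm
    rw [Subgroup.mem_comap, QuotientGroup.mk'_apply, (QuotientGroup.eq_one_iff m).2 hm]
    exact one_mem _
  have hnt : Nontrivial (H ⧸ M) := by
    rw [← not_subsingleton_iff_nontrivial]
    intro hs
    exact hne (QuotientGroup.subgroup_eq_top_of_subsingleton M hs)
  have hMZ' : ∃ z ∈ Z, z ∉ M := by
    obtain ⟨z, hz, hz1⟩ := (Subgroup.bot_or_exists_ne_one _).resolve_left
      (Group.IsNilpotent.center_ne_bot (H ⧸ M))
    obtain ⟨z, rfl⟩ := QuotientGroup.mk_surjective z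
    exact ⟨z, hz, fun h => hz1 ((QuotientGroup.eq_one_iff z).2 h)⟩
  -- central elements modulo `M` have invariant logarithms modulo `W`
  have hZ1 : ∀ z ∈ Z, ∀ g, conjMap (σ g) (D z) - D z ∈ W := by
    intro z hz g
    have := hD.mul_left_sub_mem hMn (hZ z hz g) z
    rwa [inv_mul_cancel_right, hD.conj] at this
  have hZ2 : ∀ z ∈ Z, ∀ g, conjMap (σ z) (D g) - D g ∈ W := by
    intro z hz g
    have h1 : z * g * z⁻¹ * g⁻¹ ∈ M := by
      have := M.inv_mem (hZ z hz g)
      simpa [mul_assoc] using this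
    have := hD.mul_left_sub_mem hMn h1 g
    rwa [inv_mul_cancel_right, hD.conj] at this
  let B : Set H := {h | D h ∈ logSpan D Z}
  -- a basis of the span of the central logarithms modulo `W`
  let s : Set ((E → E) ⧸ W) := (fun z => W.mkQ (D z)) '' (Z : Set H)
  obtain ⟨b, hbs, hspan, hli⟩ := exists_linearIndependent E s
  have hlift : ∀ i : b, ∃ z ∈ Z, W.mkQ (D z) = i := fun i => hbs i.2
  choose ζ hζZ hζ using hlift
  have hconj_comb : ∀ (g : H) (l : b →₀ E), conjMap (σ g) (∑ i ∈ l.support, l i • D (ζ i)) -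
      ∑ i ∈ l.support, σ g (l i) • D (ζ i) ∈ W := by
    intro g l
    rw [conjMap_sum, ← Finset.sum_sub_distrib]
    refine sum_mem fun i _ => ?_
    rw [conjMap_smul, ← smul_sub]
    exact W.smul_mem _ (hZ1 _ (hζZ i) g)
  have hcoef : ∀ h ∈ B, ∃ l : b →₀ E, D h - ∑ i ∈ l.support, l i • D (ζ i) ∈ W ∧
      ∀ z ∈ Z, ∀ i, σ z (l i) = l i := by
    intro h hh
    have h1 : W.mkQ (D h) ∈ Submodule.span E b := by
      rw [hspan]
      have := Submodule.mem_map_of_mem (f := W.mkQ) (show D h ∈ logSpan D Z from hh)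
      rw [logSpan, Submodule.map_span, Set.image_image] at this
      exact this
    obtain ⟨l, hl⟩ := (Finsupp.mem_span_iff_linearCombination E b _).1 h1
    have h2 : D h - ∑ i ∈ l.support, l i • D (ζ i) ∈ W := by
      rw [← Submodule.Quotient.mk_eq_zero, ← Submodule.mkQ_apply, map_sub, ← hl,
        Finsupp.linearCombination_apply, Finsupp.sum, map_sum, sub_eq_zero]
      exact Finset.sum_congr rfl fun i _ => by rw [map_smul, hζ]
    refine ⟨l, h2, fun z hz i => ?_⟩
    have h3 := hD.conjMap_mem_logSpan hMn z h2
    rw [conjMap_sub] at h3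
    have h4 : ∑ i ∈ l.support, (σ z (l i) - l i) • D (ζ i) ∈ W := by
      have := sub_mem (sub_mem (add_mem h3 (hconj_comb z l)) (hZ2 z hz h)) h2
      rw [← neg_mem_iff]
      convert this using 1
      simp only [sub_smul, Finset.sum_sub_distrib]
      abel
    by_cases hi : i ∈ l.support
    · have h5 := linearIndependent_iff'.1 hli l.support (fun i => σ z (l i) - l i) (by
        rw [← Submodule.Quotient.mk_eq_zero, ← Submodule.mkQ_apply, map_sum] at h4
        rw [← h4]
        exact Finset.sum_congr rfl fun i _ => by rw [map_smul, hζ]) i hi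
      exact sub_eq_zero.1 h5
    · rw [Finsupp.notMem_support_iff.1 hi, map_zero]
  -- hence the subgroup generated by `B` acts trivially on the logarithms of `B` modulo `W`
  have hfixB : ∀ h ∈ Subgroup.closure B, ∀ f : E, (∀ z ∈ Z, σ z f = f) → σ h f = f := by
    intro h hh f hf
    induction hh using Subgroup.closure_induction with
    | mem x hx =>
      rw [← hD.fix]
      have : ∀ φ ∈ logSpan D Z, φ f = 0 := by
        intro φ hφ
        induction hφ using Submodule.span_induction with
        | mem x hx => obtain ⟨z, hz, rfl⟩ := hx; exact (hD.fix z f).2 (hf z hz)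
        | zero => rfl
        | add x y _ _ hx hy => simp [hx, hy]
        | smul a x _ hx => simp [hx]
      exact this _ hx
    | one => simp
    | mul x y _ _ hx hy => rw [map_mul, RingAut.mul_apply, hy, hx]
    | inv x _ hx =>
      rw [map_inv]
      nth_rewrite 1 [← hx]
      exact (σ x).symm_apply_apply f
  have htriv : ∀ g ∈ Subgroup.closure B, ∀ h ∈ B, conjMap (σ g) (D h) - D h ∈ W := by
    intro g hg h hh
    obtain ⟨l, hl, hlf⟩ := hcoef h hh
    have h1 := hD.conjMap_mem_logSpan hMn g hl
    rw [conjMap_sub] at h1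
    have h2 := hconj_comb g l
    simp only [hfixB g hg _ (fun z hz => hlf z hz _)] at h2
    have := sub_mem (add_mem h1 h2) hl
    convert this using 1
    abel
  -- by nilpotency `B` commutes with the subgroup it generates, modulo `M`
  have hcomm : ∀ y ∈ B, ∀ x ∈ Subgroup.closure B, x * y * x⁻¹ * y⁻¹ ∈ M := by
    intro y hy
    have hstep : ∀ x ∈ Subgroup.closure B,
        (x * y * x⁻¹ * y⁻¹) * y * (x * y * x⁻¹ * y⁻¹)⁻¹ * y⁻¹ ∈ M → x * y * x⁻¹ * y⁻¹ ∈ M := by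
      intro x hx hc
      apply hMc
      have h1 := hD.log_mul M hMn _ _ hc
      rw [inv_mul_cancel_right, hD.conj] at h1
      have := sub_mem (htriv x hx y hy) h1
      convert this using 1
      abel
    let c : H → H := fun x => x * y * x⁻¹ * y⁻¹
    have hcB : ∀ n, ∀ x ∈ Subgroup.closure B, c^[n] x ∈ Subgroup.closure B := by
      intro n
      induction n with
      | zero => exact fun x hx => hx
      | succ n ih =>
        intro x hx
        rw [Function.iterate_succ_apply']
        have hy' := Subgroup.subset_closure hy
        have hx' := ih x hx
        exact mul_mem (mul_mem (mul_mem hx' hy') (inv_mem hx')) (inv_mem hy')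
    have hcn : ∀ n x, c^[n] x ∈ (⊤ : Subgroup H).lowerCentralSeries n := by
      intro n x
      induction n with
      | zero => simp
      | succ n ih =>
        rw [Function.iterate_succ_apply']
        exact Subgroup.commutator_mem_commutator ih (Subgroup.mem_top y)
    intro x hx
    have hdesc : ∀ n, c^[n + 1] x ∈ M → c x ∈ M := by
      intro n
      induction n with
      | zero => exact id
      | succ n ih =>
        intro h
        apply ih
        rw [Function.iterate_succ_apply', Function.iterate_succ_apply'] at h
        rw [Function.iterate_succ_apply']
        exact hstep _ (hcB n x hx) h
    obtain ⟨n, hn⟩ := (Subgroup.nilpotent_iff_lowerCentralSeries (G := H)).1 inferInstance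
    apply hdesc n
    have h1 : c^[n + 1] x ∈ (⊤ : Subgroup H).lowerCentralSeries n :=
      (⊤ : Subgroup H).lowerCentralSeries_antitone (Nat.le_succ n) (hcn (n + 1) x)
    rw [hn, Subgroup.mem_bot] at h1
    rw [h1]
    exact one_mem _
  have hle : W ≤ logSpan D Z := logSpan_mono hMZ
  have hmulB : ∀ x ∈ B, ∀ y ∈ B, x * y ∈ B := by
    intro x hx y hy
    have h1 := hle (hD.log_mul M hMn x y (hcomm y hy x (Subgroup.subset_closure hx)))
    have := add_mem (add_mem h1 hx) hy
    change D (x * y) ∈ logSpan D Z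
    convert this using 1
    abel
  let M' : Subgroup H :=
    { carrier := B
      mul_mem' := fun {x y} hx hy => hmulB x hx y hy
      one_mem' := by
        change D 1 ∈ logSpan D Z
        rw [hD.map_one]; exact zero_mem _
      inv_mem' := by
        intro x hx
        have h1 := hle (hD.log_mul M hMn x x⁻¹ (by simp))
        rw [mul_inv_cancel, hD.map_one] at h1
        have := neg_mem (add_mem h1 hx)
        change D x⁻¹ ∈ logSpan D Z
        convert this using 1
        abel }
  have hZM' : Z ≤ M' := fun z hz => mem_logSpan hz
  have hspan' : logSpan D M' = logSpan D Z := by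
    apply le_antisymm _ (logSpan_mono hZM')
    refine Submodule.span_le.2 ?_
    rintro _ ⟨h, hh, rfl⟩
    exact hh
  refine ⟨M', ⟨⟨fun h hh g => ?_⟩, fun h hh => ?_⟩, ?_, ?_⟩
  · change D _ ∈ logSpan D Z
    rw [hD.conj]
    exact hD.conjMap_mem_logSpan hZn g hh
  · rw [hspan'] at hh
    exact hh
  · obtain ⟨z, hz, hzM⟩ := hMZ'
    rw [hspan']
    exact lt_of_le_of_ne hle fun h => hzM (hMc z (by rw [h]; exact mem_logSpan hz))
  · rw [Subgroup.commutator_le]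
    intro x hx y hy
    exact hcomm y hy x (Subgroup.subset_closure hx)

/-- The derived length of a nilpotent group of automorphisms with logarithms is at most the
dimension of the space spanned by these logarithms. -/
theorem derivedSeries_eq_bot [Group.IsNilpotent H] (hD : IsLogarithm σ D)
    (hσ : Function.Injective σ) (d : ℕ) [Module.Finite E (logSpan D (⊤ : Subgroup H))]
    (hd : Module.finrank E (logSpan D (⊤ : Subgroup H)) ≤ d) : derivedSeries H d = ⊥ := by
  have key : ∀ n : ℕ, ∀ M : Subgroup H, IsLogClosed D M →
      Module.finrank E (logSpan D (⊤ : Subgroup H)) ≤ Module.finrank E (logSpan D M) + n →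
      derivedSeries H n ≤ M := by
    intro n
    induction n with
    | zero =>
      intro M hM h
      have h1 := Submodule.eq_of_le_of_finrank_le (logSpan_mono (D := D) (le_top : M ≤ ⊤)) h
      intro x _
      exact hM.2 x (h1 ▸ mem_logSpan (Subgroup.mem_top x))
    | succ n ih =>
      intro M hM h
      by_cases hne : M = ⊤
      · rw [hne]; exact le_top
      obtain ⟨M', hM', hlt, hc⟩ := hD.exists_logClosed hM hne
      have : Module.Finite E (logSpan D M') :=
        Submodule.finiteDimensional_of_le (logSpan_mono (D := D) (le_top : M' ≤ ⊤))
      have h1 := Submodule.finrank_lt_finrank_of_lt hlt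
      have h2 := ih M' hM' (by omega)
      rw [derivedSeries_succ]
      exact (Subgroup.commutator_mono h2 h2).trans hc
  have hbot : logSpan D (⊥ : Subgroup H) = ⊥ := by
    simp [logSpan, hD.map_one]
  rw [eq_bot_iff]
  refine key d ⊥ ⟨inferInstance, fun h hh => ?_⟩ (by omega)
  rw [hbot, Submodule.mem_bot] at hh
  rw [Subgroup.mem_bot]
  apply hσ
  ext x
  simpa using (hD.fix h x).1 (congrFun hh x)

end IsLogarithm

end Core

section Logarithm

open Filter Topology

variable {E : Type*} [NormedField E]

/-- The automorphism `τ` moves every element by at most `s` in the relative sense. -/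
def IsNear (τ : E ≃+* E) (s : ℝ) : Prop := ∀ x, ‖τ x - x‖ ≤ s * ‖x‖

namespace IsNear

variable {τ υ : E ≃+* E} {s t : ℝ}

lemma mono (h : IsNear τ s) (hst : s ≤ t) : IsNear τ t := fun x =>
  (h x).trans (mul_le_mul_of_nonneg_right hst (norm_nonneg x))

lemma nonneg (h : IsNear τ s) : 0 ≤ s := by
  have := (norm_nonneg _).trans (h 1)
  simpa using this

variable [IsUltrametricDist E]

lemma norm_add_le_of_le {x y : E} {r : ℝ} (hx : ‖x‖ ≤ r) (hy : ‖y‖ ≤ r) : ‖x + y‖ ≤ r :=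
  (IsUltrametricDist.norm_add_le_max x y).trans (max_le hx hy)

lemma norm_sub_le_of_le {x y : E} {r : ℝ} (hx : ‖x‖ ≤ r) (hy : ‖y‖ ≤ r) : ‖x - y‖ ≤ r := by
  rw [sub_eq_add_neg]
  exact norm_add_le_of_le hx (by rwa [norm_neg])

lemma norm_apply_le (h : IsNear τ s) (hs : s ≤ 1) (x : E) : ‖τ x‖ ≤ ‖x‖ := by
  rw [← sub_add_cancel (τ x) x]
  exact norm_add_le_of_le ((h.mono hs x).trans (one_mul _).le) le_rfl

lemma mul (h : IsNear τ s) (h' : IsNear υ s) (hs : s ≤ 1) : IsNear (τ * υ) s := by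
  intro x
  have : (τ * υ) x - x = (τ (υ x) - υ x) + (υ x - x) := by rw [RingAut.mul_apply]; ring
  rw [this]
  refine norm_add_le_of_le ((h _).trans ?_) (h' x)
  exact mul_le_mul_of_nonneg_left (h'.norm_apply_le hs x) h.nonneg

lemma norm_apply (h : IsNear τ s) (hs : s < 1) (x : E) : ‖τ x‖ = ‖x‖ := by
  refine le_antisymm (h.norm_apply_le hs.le x) ?_
  by_contra! hlt
  have h1 : ‖x‖ ≤ max ‖τ x‖ ‖τ x - x‖ := by
    simpa using norm_sub_le_of_le (le_max_left ‖τ x‖ ‖τ x - x‖) (le_max_right _ _)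
  have h2 := h x
  have h3 : 0 < ‖x‖ := (norm_nonneg _).trans_lt hlt
  rcases le_max_iff.1 h1 with h4 | h4
  · exact absurd h4 (not_le.2 hlt)
  · nlinarith

lemma inv (h : IsNear τ s) (hs : s < 1) : IsNear τ⁻¹ s := by
  intro x
  obtain ⟨y, rfl⟩ := τ.surjective x
  have : τ⁻¹ (τ y) = y := τ.symm_apply_apply y
  rw [this, norm_sub_rev, h.norm_apply hs]
  exact h y

lemma norm_pow_sub_le (h : IsNear τ s) (hs : s ≤ 1) (n : ℕ) (x : E) :
    ‖(τ ^ n) x - x‖ ≤ ‖τ x - x‖ := by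
  induction n with
  | zero => simp
  | succ n ih =>
    have : (τ ^ (n + 1)) x - x = (τ ((τ ^ n) x - x)) + (τ x - x) := by
      rw [pow_succ', RingAut.mul_apply, map_sub]; ring
    rw [this]
    exact norm_add_le_of_le ((h.norm_apply_le hs _).trans ih) le_rfl

lemma norm_pow_sub_sub_le (h : IsNear τ s) (hs : s ≤ 1) (n : ℕ) (x : E) :
    ‖(τ ^ n) x - x - n * (τ x - x)‖ ≤ s * ‖τ x - x‖ := by
  induction n with
  | zero => simpa using mul_nonneg h.nonneg (norm_nonneg _)
  | succ n ih =>
    have : (τ ^ (n + 1)) x - x - (n + 1 : ℕ) * (τ x - x) =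
        ((τ ^ n) x - x - n * (τ x - x)) + ((τ ^ n) (τ x - x) - (τ x - x)) := by
      rw [pow_succ, RingAut.mul_apply, map_sub]; push_cast; ring
    rw [this]
    exact norm_add_le_of_le ih ((h.norm_pow_sub_le hs n _).trans (h _))

variable {p : ℕ}

lemma pow_natCast (h : IsNear τ s) (hs : s ≤ ‖(p : E)‖) : IsNear (τ ^ p) (‖(p : E)‖ * s) := by
  intro x
  have hp1 : ‖(p : E)‖ ≤ 1 := IsUltrametricDist.norm_natCast_le_one E p
  rw [← sub_add_cancel ((τ ^ p) x - x) (p * (τ x - x)), mul_assoc]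
  have h1 : ‖(p : E)‖ * ‖τ x - x‖ ≤ ‖(p : E)‖ * (s * ‖x‖) :=
    mul_le_mul_of_nonneg_left (h x) (norm_nonneg _)
  refine norm_add_le_of_le ((h.norm_pow_sub_sub_le (hs.trans hp1) p x).trans
    ((mul_le_mul_of_nonneg_right hs (norm_nonneg _)).trans h1)) ?_
  rwa [norm_mul]

lemma pow_pow (h : IsNear τ s) (hs : s ≤ ‖(p : E)‖) (n : ℕ) :
    IsNear (τ ^ p ^ n) (‖(p : E)‖ ^ n * s) := by
  have hp1 : ‖(p : E)‖ ≤ 1 := IsUltrametricDist.norm_natCast_le_one E p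
  induction n with
  | zero => simpa using h
  | succ n ih =>
    rw [pow_succ, pow_mul, pow_succ', mul_assoc]
    exact ih.pow_natCast ((mul_le_of_le_one_left h.nonneg (pow_le_one₀ (norm_nonneg _) hp1)).trans hs)

end IsNear

/-- The approximations `(τ ^ (p ^ n) - 1) / p ^ n` of the logarithm of `τ`. -/
def logApprox (p : ℕ) (τ : E ≃+* E) (n : ℕ) (x : E) : E := ((τ ^ p ^ n) x - x) / (p : E) ^ n

/-- The logarithm of a field automorphism close to the identity. -/
noncomputable def logMap (p : ℕ) (τ : E ≃+* E) (x : E) : E :=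
  limUnder atTop fun n => logApprox p τ n x

variable {p : ℕ} {τ : E ≃+* E} {s : ℝ}

lemma logApprox_zero (x : E) : logApprox p τ 0 x = τ x - x := by simp [logApprox]

lemma logApprox_add (τ : E ≃+* E) (n : ℕ) (x y : E) :
    logApprox p τ n (x + y) = logApprox p τ n x + logApprox p τ n y := by
  simp only [logApprox, map_add]; ring

lemma logApprox_mul (hp0 : (p : E) ≠ 0) (τ : E ≃+* E) (n : ℕ) (x y : E) :
    logApprox p τ n (x * y) = logApprox p τ n x * y + x * logApprox p τ n y +
      (p : E) ^ n * (logApprox p τ n x * logApprox p τ n y) := by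
  simp only [logApprox, map_mul]; field_simp; ring

variable [IsUltrametricDist E]

lemma norm_logApprox_succ_sub_le (hp0 : (p : E) ≠ 0) (h : IsNear τ s)
    (hs : s ≤ ‖(p : E)‖) (n : ℕ) (x : E) :
    ‖logApprox p τ (n + 1) x - logApprox p τ n x‖ ≤
      ‖(p : E)‖ ^ n * (s / ‖(p : E)‖) * ‖logApprox p τ n x‖ := by
  have hp1 : ‖(p : E)‖ ≤ 1 := IsUltrametricDist.norm_natCast_le_one E p
  have hp : 0 < ‖(p : E)‖ := norm_pos_iff.2 hp0
  have hle : ‖(p : E)‖ ^ n * s ≤ 1 :=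
    (mul_le_of_le_one_left h.nonneg (pow_le_one₀ (norm_nonneg _) hp1)).trans (hs.trans hp1)
  have h1 := (h.pow_pow hs n).norm_pow_sub_sub_le hle p x
  have h2 : logApprox p τ (n + 1) x - logApprox p τ n x =
      (((τ ^ p ^ n) ^ p) x - x - p * ((τ ^ p ^ n) x - x)) / (p : E) ^ (n + 1) := by
    rw [logApprox, logApprox, ← pow_mul, ← pow_succ]
    field_simp
    ring
  rw [h2, norm_div, norm_pow, div_le_iff₀ (by positivity)]
  refine h1.trans (le_of_eq ?_)
  rw [logApprox, norm_div, norm_pow]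
  field_simp
  ring

lemma norm_logApprox_sub_le (hp0 : (p : E) ≠ 0) (h : IsNear τ s) (hs : s ≤ ‖(p : E)‖)
    (n : ℕ) (x : E) :
    ‖logApprox p τ n x - (τ x - x)‖ ≤ s / ‖(p : E)‖ * ‖τ x - x‖ ∧
      ‖logApprox p τ n x‖ ≤ ‖τ x - x‖ := by
  have hp : 0 < ‖(p : E)‖ := norm_pos_iff.2 hp0
  have hp1 : ‖(p : E)‖ ≤ 1 := IsUltrametricDist.norm_natCast_le_one E p
  have hs0 := h.nonneg
  have hr : s / ‖(p : E)‖ ≤ 1 := (div_le_one hp).2 hs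
  induction n with
  | zero =>
    rw [logApprox_zero]
    refine ⟨?_, le_rfl⟩
    rw [sub_self, norm_zero]
    positivity
  | succ n ih =>
    have h1 := norm_logApprox_succ_sub_le hp0 h hs n x
    have h2 : ‖(p : E)‖ ^ n * (s / ‖(p : E)‖) * ‖logApprox p τ n x‖ ≤
        s / ‖(p : E)‖ * ‖τ x - x‖ := by
      apply mul_le_mul _ ih.2 (norm_nonneg _) (by positivity)
      exact mul_le_of_le_one_left (by positivity) (pow_le_one₀ hp.le hp1)
    have h3 : ‖logApprox p τ (n + 1) x - (τ x - x)‖ ≤ s / ‖(p : E)‖ * ‖τ x - x‖ := by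
      rw [← sub_add_sub_cancel _ (logApprox p τ n x)]
      exact IsNear.norm_add_le_of_le (h1.trans h2) ih.1
    refine ⟨h3, ?_⟩
    rw [← sub_add_cancel (logApprox p τ (n + 1) x) (τ x - x)]
    exact IsNear.norm_add_le_of_le
      (h3.trans (mul_le_of_le_one_left (norm_nonneg _) hr)) le_rfl

section Limit

variable [CompleteSpace E]

lemma tendsto_logMap (hp0 : (p : E) ≠ 0) (hp1 : ‖(p : E)‖ < 1)
    (h : IsNear τ s) (hs : s ≤ ‖(p : E)‖) (x : E) :
    Tendsto (fun n => logApprox p τ n x) atTop (𝓝 (logMap p τ x)) := by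
  refine CauchySeq.tendsto_limUnder ?_
  refine cauchySeq_of_le_geometric ‖(p : E)‖ ‖τ x - x‖ hp1 fun n => ?_
  have hp : 0 < ‖(p : E)‖ := norm_pos_iff.2 hp0
  have hs0 := h.nonneg
  rw [dist_comm, dist_eq_norm, mul_comm]
  refine (norm_logApprox_succ_sub_le hp0 h hs n x).trans ?_
  refine mul_le_mul ?_ (norm_logApprox_sub_le hp0 h hs n x).2 (norm_nonneg _) (by positivity)
  exact mul_le_of_le_one_right (by positivity) ((div_le_one hp).2 hs)

lemma norm_logMap_sub_le (hp0 : (p : E) ≠ 0) (hp1 : ‖(p : E)‖ < 1)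
    (h : IsNear τ s) (hs : s ≤ ‖(p : E)‖) (x : E) :
    ‖logMap p τ x - (τ x - x)‖ ≤ s / ‖(p : E)‖ * ‖τ x - x‖ :=
  le_of_tendsto ((tendsto_logMap hp0 hp1 h hs x).sub_const _).norm
    (Eventually.of_forall fun n => (norm_logApprox_sub_le hp0 h hs n x).1)

lemma norm_logMap_le (hp0 : (p : E) ≠ 0) (hp1 : ‖(p : E)‖ < 1)
    (h : IsNear τ s) (hs : s ≤ ‖(p : E)‖) (x : E) :
    ‖logMap p τ x‖ ≤ ‖x‖ :=
  le_of_tendsto (tendsto_logMap hp0 hp1 h hs x).norm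
    (Eventually.of_forall fun n => (norm_logApprox_sub_le hp0 h hs n x).2.trans
      ((h.mono (hs.trans hp1.le) x).trans (one_mul _).le))

lemma logMap_add (hp0 : (p : E) ≠ 0) (hp1 : ‖(p : E)‖ < 1)
    (h : IsNear τ s) (hs : s ≤ ‖(p : E)‖) (x y : E) :
    logMap p τ (x + y) = logMap p τ x + logMap p τ y := by
  refine tendsto_nhds_unique (tendsto_logMap hp0 hp1 h hs _) ?_
  simp only [logApprox_add]
  exact (tendsto_logMap hp0 hp1 h hs x).add (tendsto_logMap hp0 hp1 h hs y)

lemma logMap_mul (hp0 : (p : E) ≠ 0) (hp1 : ‖(p : E)‖ < 1)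
    (h : IsNear τ s) (hs : s ≤ ‖(p : E)‖) (x y : E) :
    logMap p τ (x * y) = x * logMap p τ y + y * logMap p τ x := by
  refine tendsto_nhds_unique (tendsto_logMap hp0 hp1 h hs _) ?_
  simp only [logApprox_mul hp0]
  have h1 := tendsto_logMap hp0 hp1 h hs x
  have h2 := tendsto_logMap hp0 hp1 h hs y
  have h3 : Tendsto (fun n => (p : E) ^ n) atTop (𝓝 0) :=
    tendsto_pow_atTop_nhds_zero_of_norm_lt_one hp1
  convert ((h1.mul_const y).add (h2.const_mul x)).add (h3.mul (h1.mul h2)) using 2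
  ring

lemma logMap_continuous (hp0 : (p : E) ≠ 0) (hp1 : ‖(p : E)‖ < 1)
    (h : IsNear τ s) (hs : s ≤ ‖(p : E)‖) : Continuous (logMap p τ) := by
  let f : E →+ E := AddMonoidHom.mk' (logMap p τ) (logMap_add hp0 hp1 h hs)
  refine AddMonoidHomClass.continuous_of_bound f 1 fun x => ?_
  rw [one_mul]
  exact norm_logMap_le hp0 hp1 h hs x

lemma logMap_eq_zero_iff (hp0 : (p : E) ≠ 0) (hp1 : ‖(p : E)‖ < 1)
    (h : IsNear τ s) (hs : s < ‖(p : E)‖) (x : E) :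
    logMap p τ x = 0 ↔ τ x = x := by
  have h1 := norm_logMap_sub_le hp0 hp1 h hs.le x
  have hr : s / ‖(p : E)‖ < 1 := (div_lt_one (norm_pos_iff.2 hp0)).2 hs
  constructor
  · intro h0
    rw [h0, zero_sub, norm_neg] at h1
    have h2 := norm_nonneg (τ x - x)
    have h3 : ‖τ x - x‖ = 0 := by nlinarith
    exact sub_eq_zero.1 (norm_eq_zero.1 h3)
  · intro h0
    simpa [h0] using h1

lemma logMap_conj (hp0 : (p : E) ≠ 0) (hp1 : ‖(p : E)‖ < 1)
    {g : E ≃+* E} (hg : Continuous g) (h : IsNear τ s) (hs : s ≤ ‖(p : E)‖)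
    (h' : IsNear (g * τ * g⁻¹) s) : logMap p (g * τ * g⁻¹) = conjMap g (logMap p τ) := by
  ext x
  refine tendsto_nhds_unique (tendsto_logMap hp0 hp1 h' hs x) ?_
  have h1 := (hg.tendsto _).comp (tendsto_logMap hp0 hp1 h hs (g.symm x))
  refine h1.congr fun n => ?_
  simp only [Function.comp, logApprox, conj_pow, RingAut.mul_apply, map_div₀, map_sub, map_pow,
    map_natCast, RingEquiv.apply_symm_apply]
  rfl

end Limit

end Logarithm

section AnalyticBound

open Filter Topology

variable {H E : Type*} [Group H] [NontriviallyNormedField E] {p : ℕ} {σ : H →* (E ≃+* E)}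

lemma logApprox_sub_sub (α β τ : E ≃+* E) (n : ℕ) (x : E) :
    logApprox p τ n x - logApprox p α n x - logApprox p β n x =
      ((τ ^ p ^ n) x - (α ^ p ^ n) x - (β ^ p ^ n) x + x) / (p : E) ^ n := by
  simp only [logApprox]; ring

/-- The continuous derivations of `E` killing the elements fixed by `σ`. -/
def fixedDerivations (σ : H →* (E ≃+* E)) : Submodule E (E → E) where
  carrier := {φ | Continuous φ ∧ (∀ x y, φ (x + y) = φ x + φ y) ∧
    (∀ x y, φ (x * y) = x * φ y + y * φ x) ∧ ∀ x, (∀ h, σ h x = x) → φ x = 0}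
  add_mem' := by
    rintro φ ψ ⟨h1, h2, h3, h4⟩ ⟨k1, k2, k3, k4⟩
    refine ⟨h1.add k1, fun x y => ?_, fun x y => ?_, fun x hx => ?_⟩
    · simp only [Pi.add_apply, h2, k2]; ring
    · simp only [Pi.add_apply, h3, k3]; ring
    · simp [h4 x hx, k4 x hx]
  zero_mem' := ⟨continuous_const, by simp, by simp, by simp⟩
  smul_mem' := by
    rintro c φ ⟨h1, h2, h3, h4⟩
    refine ⟨h1.const_smul c, fun x y => ?_, fun x y => ?_, fun x hx => ?_⟩
    · simp only [Pi.smul_apply, smul_eq_mul, h2]; ring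
    · simp only [Pi.smul_apply, smul_eq_mul, h3]; ring
    · simp [h4 x hx]

/-- A derivation in `fixedDerivations` vanishing at `s` is zero, provided that `E` is
topologically algebraic over the fixed elements and `s`. -/
lemma eq_zero_of_mem_fixedDerivations [CharZero E] {ι : Type*} {s : ι → E}
    (hs : ∀ K : Subfield E, IsClosed (K : Set E) → (∀ x, (∀ h, σ h x = x) → x ∈ K) →
      (∀ i, s i ∈ K) → (∀ x, IsAlgebraic K x → x ∈ K) → K = ⊤)
    {φ : E → E} (hφ : φ ∈ fixedDerivations σ) (h0 : ∀ i, φ (s i) = 0) : φ = 0 := by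
  obtain ⟨h1, h2, h3, h4⟩ := hφ
  have hone : φ 1 = 0 := h4 1 (by simp)
  have hzero : φ 0 = 0 := h4 0 (by simp)
  have hneg : ∀ x, φ (-x) = -φ x := by
    intro x
    have := h2 x (-x)
    rw [add_neg_cancel, hzero] at this
    exact (neg_eq_of_add_eq_zero_right this.symm).symm
  let K : Subfield E :=
    { carrier := {x | φ x = 0}
      mul_mem' := fun {x y} hx hy => by
        rw [Set.mem_ofPred_eq] at *
        rw [h3, hx, hy]; simp
      one_mem' := hone
      add_mem' := fun {x y} hx hy => by
        rw [Set.mem_ofPred_eq] at *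
        rw [h2, hx, hy]; simp
      zero_mem' := hzero
      neg_mem' := fun {x} hx => by
        rw [Set.mem_ofPred_eq] at *
        rw [hneg, hx]; simp
      inv_mem' := fun x hx => by
        change φ x = 0 at hx
        change φ x⁻¹ = 0
        by_cases hx0 : x = 0
        · simp [hx0, hzero]
        · have := h3 x x⁻¹
          rw [mul_inv_cancel₀ hx0, hone, hx, mul_zero, add_zero] at this
          exact (mul_eq_zero.1 this.symm).resolve_left hx0 }
  have hK : ∀ x : K, φ x = 0 := fun x => x.2
  have hKtop : K = ⊤ := by
    refine hs K (isClosed_singleton.preimage h1) h4 h0 fun x hx => ?_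
    let δ : Derivation K E E :=
      { toFun := φ
        map_add' := h2
        map_smul' := fun c y => by
          simp only [Algebra.smul_def, RingHom.id_apply]
          change φ (c * y) = c * φ y
          rw [h3, hK, mul_zero, add_zero]
        map_one_eq_zero' := hone
        leibniz' := fun a b => by simpa using h3 a b }
    have hint : IsIntegral K x := hx.isIntegral
    have h5 := δ.map_aeval (minpoly K x) x
    rw [minpoly.aeval, map_zero] at h5
    have h6 : Polynomial.aeval x (Polynomial.derivative (minpoly K x)) ≠ 0 :=
      (minpoly.irreducible hint).separable.aeval_derivative_ne_zero (minpoly.aeval K x)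
    exact (smul_eq_zero.1 h5.symm).resolve_left h6
  ext x
  have : x ∈ K := hKtop ▸ Subfield.mem_top x
  exact this

variable [IsUltrametricDist E]

lemma IsNear.continuous {τ : E ≃+* E} {s : ℝ} (h : IsNear τ s) (hs : s ≤ 1) : Continuous τ :=
  AddMonoidHomClass.continuous_of_bound τ 1 fun x => by
    rw [one_mul]; exact h.norm_apply_le hs x

variable [CompleteSpace E]

/-- Approximation of the logarithm of a product of elements commuting up to `m`. -/
lemma norm_logApprox_sub_logMap_le (hp0 : (p : E) ≠ 0) (hp1 : ‖(p : E)‖ < 1)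
    {α β τ μ : E ≃+* E} {s : ℝ} (hα : IsNear α s) (hβ : IsNear β s) (hμ : IsNear μ s)
    (hs : s ≤ ‖(p : E)‖ ^ 2) (n : ℕ) (hsn : s ≤ ‖(p : E)‖ ^ n * ‖(p : E)‖ ^ 2)
    (hτ : τ = μ * α * β) (x : E) :
    ‖(τ x - α x - β x + x) - logMap p μ x‖ ≤ ‖(p : E)‖ ^ n * ‖(p : E)‖ ^ n * ‖x‖ := by
  have hp : 0 < ‖(p : E)‖ := norm_pos_iff.2 hp0
  have hs0 := hα.nonneg
  have hs2 : s ≤ ‖(p : E)‖ := hs.trans (by rw [sq]; exact mul_le_of_le_one_left hp.le hp1.le)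
  have hs1 : s ≤ 1 := hs2.trans hp1.le
  have hsn' : s ≤ ‖(p : E)‖ ^ n :=
    hsn.trans (mul_le_of_le_one_right (by positivity) (pow_le_one₀ hp.le hp1.le))
  have hss : s * s ≤ ‖(p : E)‖ ^ n * ‖(p : E)‖ ^ n := mul_le_mul hsn' hsn' hs0 (by positivity)
  have h1 : ‖μ (α (β x) - x) - (α (β x) - x)‖ ≤ ‖(p : E)‖ ^ n * ‖(p : E)‖ ^ n * ‖x‖ := by
    refine (hμ _).trans ((mul_le_mul_of_nonneg_left ((hα.mul hβ hs1) x) hs0).trans ?_)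
    rw [← mul_assoc]
    exact mul_le_mul_of_nonneg_right hss (norm_nonneg _)
  have h2 : ‖α (β x - x) - (β x - x)‖ ≤ ‖(p : E)‖ ^ n * ‖(p : E)‖ ^ n * ‖x‖ := by
    refine (hα _).trans ((mul_le_mul_of_nonneg_left (hβ x) hs0).trans ?_)
    rw [← mul_assoc]
    exact mul_le_mul_of_nonneg_right hss (norm_nonneg _)
  have h3 : ‖logMap p μ x - (μ x - x)‖ ≤ ‖(p : E)‖ ^ n * ‖(p : E)‖ ^ n * ‖x‖ := by
    refine (norm_logMap_sub_le hp0 hp1 hμ hs2 x).trans ?_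
    refine (mul_le_mul_of_nonneg_left (hμ x) (by positivity)).trans ?_
    rw [← mul_assoc]
    refine mul_le_mul_of_nonneg_right ?_ (norm_nonneg _)
    refine mul_le_mul ?_ hsn' hs0 (by positivity)
    rw [div_le_iff₀ hp]
    refine hsn.trans (mul_le_mul_of_nonneg_left ?_ (by positivity))
    rw [sq]
    exact mul_le_of_le_one_left hp.le hp1.le
  have key : (τ x - α x - β x + x) - logMap p μ x =
      (μ (α (β x) - x) - (α (β x) - x)) + (α (β x - x) - (β x - x)) -
        (logMap p μ x - (μ x - x)) := by
    rw [hτ]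
    simp only [RingAut.mul_apply, map_sub]
    ring
  rw [key]
  exact IsNear.norm_sub_le_of_le (IsNear.norm_add_le_of_le h1 h2) h3

/-- The `p`-adic logarithm satisfies the formal properties of a logarithm. -/
lemma isLogarithm_logMap (hp0 : (p : E) ≠ 0) (hp1 : ‖(p : E)‖ < 1)
    (hσ : ∀ h, IsNear (σ h) (‖(p : E)‖ ^ 2))
    [Module.Finite E (logSpan (fun h => logMap p (σ h)) (⊤ : Subgroup H))] :
    IsLogarithm σ (fun h => logMap p (σ h)) := by
  have hp : 0 < ‖(p : E)‖ := norm_pos_iff.2 hp0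
  have hs : ‖(p : E)‖ ^ 2 < ‖(p : E)‖ := by
    rw [sq]; exact mul_lt_of_lt_one_left hp hp1
  refine ⟨fun g h => ?_, fun h x => logMap_eq_zero_iff hp0 hp1 (hσ h) hs x, ?_⟩
  · have h1 := hσ (g * h * g⁻¹)
    simp only [map_mul, map_inv] at h1 ⊢
    exact logMap_conj hp0 hp1 ((hσ g).continuous (hs.le.trans hp1.le)) (hσ h) hs.le h1
  intro M hM a b hab
  change _ ∈ logSpan (fun h => logMap p (σ h)) M
  have : Module.Finite E (logSpan (fun h => logMap p (σ h)) M) :=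
    Submodule.finiteDimensional_of_le (logSpan_mono (le_top : M ≤ ⊤))
  have hcl := Submodule.closed_of_finiteDimensional (logSpan (fun h => logMap p (σ h)) M)
  let m : ℕ → H := fun n => (a * b) ^ p ^ n * (a ^ p ^ n * b ^ p ^ n)⁻¹
  have hm : ∀ n, m n ∈ M := by
    intro n
    have hc : Commute (a : H ⧸ M) b := by
      have := (QuotientGroup.eq_one_iff (N := M) _).2 hab
      simp only [QuotientGroup.mk_mul, QuotientGroup.mk_inv] at this
      rw [mul_inv_eq_one, mul_inv_eq_iff_eq_mul] at this
      exact this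
    rw [← QuotientGroup.eq_one_iff]
    simp only [m, QuotientGroup.mk_mul, QuotientGroup.mk_inv, QuotientGroup.mk_pow]
    rw [hc.mul_pow, mul_inv_cancel]
  have hpow : ∀ h n, IsNear (σ (h ^ p ^ n)) (‖(p : E)‖ ^ n * ‖(p : E)‖ ^ 2) := by
    intro h n
    rw [map_pow]
    exact (hσ h).pow_pow hs.le n
  have hlt : ∀ n, ‖(p : E)‖ ^ n * ‖(p : E)‖ ^ 2 ≤ ‖(p : E)‖ ^ 2 := fun n =>
    mul_le_of_le_one_left (by positivity) (pow_le_one₀ hp.le hp1.le)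
  have hlt1 : ∀ n, ‖(p : E)‖ ^ n * ‖(p : E)‖ ^ 2 < 1 := fun n => (hlt n).trans_lt (hs.trans hp1)
  have hmn : ∀ n, IsNear (σ (m n)) (‖(p : E)‖ ^ n * ‖(p : E)‖ ^ 2) := by
    intro n
    have h2 := ((hpow a n).mul (hpow b n) (hlt1 n).le).inv (hlt1 n)
    have h3 := (hpow (a * b) n).mul h2 (hlt1 n).le
    simpa only [m, map_mul, map_inv] using h3
  refine hcl.mem_of_tendsto (b := atTop)
    (f := fun n => ((p : E) ^ n)⁻¹ • logMap p (σ (m n))) ?_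
    (Eventually.of_forall fun n => Submodule.smul_mem _ _ (mem_logSpan (hm n)))
  rw [tendsto_pi_nhds]
  intro x
  have hτ : ∀ h, Tendsto (fun n => logApprox p (σ h) n x) atTop (𝓝 (logMap p (σ h) x)) :=
    fun h => tendsto_logMap hp0 hp1 (hσ h) hs.le x
  have h1 := ((hτ (a * b)).sub (hτ a)).sub (hτ b)
  refine tendsto_of_tendsto_of_dist h1 ?_
  have h2 : Tendsto (fun n => ‖(p : E)‖ ^ n * ‖x‖) atTop (𝓝 0) := by
    simpa using (tendsto_pow_atTop_nhds_zero_of_lt_one hp.le hp1).mul_const ‖x‖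
  refine squeeze_zero (fun _ => dist_nonneg) (fun n => ?_) h2
  have h3 := norm_logApprox_sub_logMap_le hp0 hp1 (hpow a n) (hpow b n) (hmn n) (hlt n) n le_rfl
    (τ := σ ((a * b) ^ p ^ n)) (by rw [← map_mul, ← map_mul]; congr 1; simp [m, mul_assoc]) x
  rw [dist_eq_norm, logApprox_sub_sub, Pi.smul_apply, smul_eq_mul, ← map_pow, ← map_pow,
    ← map_pow, inv_mul_eq_div, ← sub_div, norm_div, norm_pow, div_le_iff₀ (by positivity)]
  refine h3.trans (le_of_eq ?_)
  ring

/-- A nilpotent group acting on a complete ultrametric field by automorphisms close to the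
identity has derived length at most the number of elements needed to generate the field
topologically and up to algebraic extensions over the fixed elements. -/
theorem derivedSeries_eq_bot_of_isNear [CharZero E] [Group.IsNilpotent H]
    (hσ : Function.Injective σ) (hp0 : p ≠ 0) (hp1 : ‖(p : E)‖ < 1)
    (hnear : ∀ h, IsNear (σ h) (‖(p : E)‖ ^ 2)) {d : ℕ} (s : Fin d → E)
    (hs : ∀ K : Subfield E, IsClosed (K : Set E) → (∀ x, (∀ h, σ h x = x) → x ∈ K) →
      (∀ i, s i ∈ K) → (∀ x, IsAlgebraic K x → x ∈ K) → K = ⊤) :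
    derivedSeries H d = ⊥ := by
  have hp0' : (p : E) ≠ 0 := Nat.cast_ne_zero.2 hp0
  have hp : 0 < ‖(p : E)‖ := norm_pos_iff.2 hp0'
  have hlt : ‖(p : E)‖ ^ 2 < ‖(p : E)‖ := by
    rw [sq]; exact mul_lt_of_lt_one_left hp hp1
  have hle : logSpan (fun h => logMap p (σ h)) (⊤ : Subgroup H) ≤ fixedDerivations σ := by
    refine Submodule.span_le.2 ?_
    rintro _ ⟨h, -, rfl⟩
    exact ⟨logMap_continuous hp0' hp1 (hnear h) hlt.le, logMap_add hp0' hp1 (hnear h) hlt.le,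
      logMap_mul hp0' hp1 (hnear h) hlt.le, fun x hx =>
        (logMap_eq_zero_iff hp0' hp1 (hnear h) hlt x).2 (hx h)⟩
  let ev : logSpan (fun h => logMap p (σ h)) (⊤ : Subgroup H) →ₗ[E] (Fin d → E) :=
    (LinearMap.pi fun i => LinearMap.proj (s i)) ∘ₗ Submodule.subtype _
  have hev : Function.Injective ev := by
    rw [injective_iff_map_eq_zero]
    intro φ hφ
    apply Subtype.ext
    exact eq_zero_of_mem_fixedDerivations hs (hle φ.2) fun i => congrFun hφ i
  have hfin : Module.Finite E (logSpan (fun h => logMap p (σ h)) (⊤ : Subgroup H)) :=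
    Module.Finite.of_injective ev hev
  refine (isLogarithm_logMap hp0' hp1 hnear).derivedSeries_eq_bot hσ d ?_
  simpa using LinearMap.finrank_le_finrank_of_injective hev

end AnalyticBound

section Completion

open UniformSpace

/-- `derivedSeries_eq_bot_of_isNear` without completeness. -/
theorem derivedSeries_eq_bot_of_normedField {G F : Type*} [Group G] [Group.IsNilpotent G]
    [NormedField F] [IsUltrametricDist F] [CharZero F] {p : ℕ} {τ : G →* (F ≃+* F)}
    (hτ : Function.Injective τ) (hp0 : p ≠ 0) (hp1 : ‖(p : F)‖ < 1)
    (hnear : ∀ g, IsNear (τ g) (‖(p : F)‖ ^ 2)) {d : ℕ} (s : Fin d → F)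
    (hs : ∀ K : Subfield F, (∀ x, (∀ g, τ g x = x) → x ∈ K) →
      (∀ i, s i ∈ K) → (∀ x, IsAlgebraic K x → x ∈ K) → K = ⊤) :
    derivedSeries G d = ⊥ := by
  have hle1 : ‖(p : F)‖ ^ 2 ≤ 1 := pow_le_one₀ (norm_nonneg _) hp1.le
  have hcont : ∀ g, Continuous (τ g) := fun g =>
    AddMonoidHomClass.continuous_of_bound (τ g) 1 fun x => by
      rw [one_mul]; exact (hnear g).norm_apply_le hle1 x
  have hpc : ‖(p : Completion F)‖ = ‖(p : F)‖ := by
    rw [← map_natCast (Completion.coeRingHom (α := F)) p]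
    exact Completion.norm_coe _
  let _ : NontriviallyNormedField (Completion F) :=
    { (inferInstance : NormedField (Completion F)) with
      non_trivial := by
        refine ⟨((p : F)⁻¹ : F), ?_⟩
        rw [Completion.norm_coe, norm_inv]
        exact (one_lt_inv₀ (norm_pos_iff.2 (Nat.cast_ne_zero.2 hp0))).2 hp1 }
  have hult : IsUltrametricDist (Completion F) := by
    refine IsUltrametricDist.isUltrametricDist_of_forall_norm_add_le_max_norm fun x y => ?_
    induction x, y using Completion.induction_on₂ with
    | hp => exact isClosed_le (by fun_prop) (by fun_prop)
    | ih a b =>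
      rw [← Completion.coe_add, Completion.norm_coe, Completion.norm_coe, Completion.norm_coe]
      exact IsUltrametricDist.norm_add_le_max a b
  have hchar : CharZero (Completion F) :=
    charZero_of_injective_ringHom (Completion.coeRingHom (α := F)).injective
  have hext : ∀ (e : F ≃+* F) (he : Continuous e) (he' : Continuous e.symm) (a : F),
      Completion.mapRingEquiv e he he' (a : Completion F) = (e a : F) := fun e he _ a =>
    Completion.mapRingHom_coe (f := e.toRingHom) he a
  have hcont' : ∀ g, Continuous (τ g).symm := fun g => (hcont g⁻¹).congr fun x => by
    rw [map_inv]; rfl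
  let σ : G →* (Completion F ≃+* Completion F) :=
    { toFun := fun g => Completion.mapRingEquiv (τ g) (hcont g) (hcont' g)
      map_one' := by
        ext x
        induction x using Completion.induction_on with
        | hp => exact isClosed_eq Completion.continuous_map continuous_id
        | ih a => rw [hext]; simp
      map_mul' := fun g h => by
        ext x
        induction x using Completion.induction_on with
        | hp =>
          exact isClosed_eq Completion.continuous_map
            (Completion.continuous_map.comp Completion.continuous_map)
        | ih a => rw [RingAut.mul_apply, hext, hext, hext]; simp }
  have hσ : ∀ g (a : F), σ g (a : Completion F) = (τ g a : F) := fun g a =>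
    hext (τ g) (hcont g) (hcont' g) a
  have hσc : ∀ g, Continuous (σ g) := fun g => Completion.continuous_map
  refine derivedSeries_eq_bot_of_isNear (σ := σ) ?_ hp0 (hpc.trans_lt hp1) ?_
    (fun i => (s i : Completion F)) ?_
  · intro g h hgh
    apply hτ
    ext a
    have := congrArg (fun f => f (a : Completion F)) hgh
    simp only [hσ] at this
    exact Completion.coe_injective F this
  · intro g x
    rw [hpc]
    induction x using Completion.induction_on with
    | hp =>
      exact isClosed_le ((hσc g).sub continuous_id).norm (continuous_const.mul continuous_norm)
    | ih a =>
      rw [hσ, ← Completion.coe_sub, Completion.norm_coe, Completion.norm_coe]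
      exact hnear g a
  · intro K hK hfix hsK halg
    have h1 : K.comap (Completion.coeRingHom (α := F)) = ⊤ := by
      refine hs _ (fun x hx => hfix _ fun g => by
        change σ g (x : Completion F) = x
        rw [hσ, hx]) hsK fun x hx => halg _ ?_
      obtain ⟨q, hq0, hq⟩ := hx
      let f : K.comap (Completion.coeRingHom (α := F)) →+* K :=
        (Completion.coeRingHom (α := F)).restrict _ _ fun x hx => hx
      refine ⟨q.map f, (Polynomial.map_ne_zero_iff f.injective).2 hq0, ?_⟩
      have h2 := congrArg (Completion.coeRingHom (α := F)) hq
      rw [map_zero, Polynomial.aeval_def, Polynomial.hom_eval₂] at h2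
      rw [Polynomial.aeval_def, Polynomial.eval₂_map]
      exact h2
    rw [eq_top_iff]
    rintro x -
    induction x using Completion.induction_on with
    | hp => exact hK
    | ih a =>
      have : a ∈ K.comap (Completion.coeRingHom (α := F)) := h1 ▸ Subfield.mem_top a
      exact this

/-- `derivedSeries_eq_bot_of_normedField` for a field with a nonarchimedean absolute value. -/
theorem derivedSeries_eq_bot_of_absoluteValue {G F : Type*} [Group G] [Group.IsNilpotent G]
    [Field F] [CharZero F] (v : AbsoluteValue F ℝ) (hv : IsNonarchimedean v)
    {p : ℕ} {τ : G →* (F ≃+* F)}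
    (hτ : Function.Injective τ) (hp0 : p ≠ 0) (hp1 : v p < 1)
    (hnear : ∀ g x, v (τ g x - x) ≤ v p ^ 2 * v x) {d : ℕ} (s : Fin d → F)
    (hs : ∀ K : Subfield F, (∀ x, (∀ g, τ g x = x) → x ∈ K) →
      (∀ i, s i ∈ K) → (∀ x, IsAlgebraic K x → x ∈ K) → K = ⊤) :
    derivedSeries G d = ⊥ := by
  let _ : NormedField F := v.toNormedField
  have : IsUltrametricDist F := IsUltrametricDist.isUltrametricDist_of_isNonarchimedean_norm hv
  exact derivedSeries_eq_bot_of_normedField hτ hp0 hp1 hnear s hs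

end Completion

section Valuation

open IsDedekindDomain

/-- An extension to a finite extension `F` of the valuation of a discrete valuation ring, together
with the finiteness of the integral closure. -/
lemma exists_absoluteValue_of_isDiscreteValuationRing (Λ K F : Type*) [CommRing Λ] [IsDomain Λ]
    [IsDiscreteValuationRing Λ] [Field K] [CharZero K] [Field F] [Algebra Λ K] [IsFractionRing Λ K]
    [Algebra Λ F] [Algebra K F] [IsScalarTower Λ K F] [FiniteDimensional K F] :
    ∃ v : AbsoluteValue F ℝ, IsNonarchimedean v ∧ (∀ x : Λ, v (algebraMap Λ F x) ≤ 1) ∧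
      (∀ x ∈ IsLocalRing.maximalIdeal Λ, v (algebraMap Λ F x) < 1) ∧
      ∃ n : Finset F, (∀ x ∈ n, v x ≤ 1) ∧ ∀ O : Subring F,
        (∀ x : Λ, algebraMap Λ F x ∈ O) → (∀ x ∈ n, x ∈ O) → (∀ x ∈ O, v x = 1 → x⁻¹ ∈ O) →
        ∀ x, v x ≤ 1 → x ∈ O := by
  classical
  have hsep : Algebra.IsSeparable K F := Algebra.IsAlgebraic.isSeparable_of_perfectField
  have hded := integralClosure.isDedekindDomain Λ K F
  have hfrac : IsFractionRing (integralClosure Λ F) F :=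
    integralClosure.isFractionRing_of_finite_extension K F
  have hfin : Module.Finite Λ (integralClosure Λ F) := IsIntegralClosure.finite Λ K F _
  have hinj : Function.Injective (algebraMap Λ F) := by
    rw [IsScalarTower.algebraMap_eq Λ K F]
    exact (algebraMap K F).injective.comp (IsFractionRing.injective Λ K)
  have hinj' : Function.Injective (algebraMap Λ (integralClosure Λ F)) := fun x y hxy =>
    hinj (congrArg Subtype.val hxy)
  obtain ⟨Q, hQ, hQc⟩ := Ideal.exists_ideal_over_maximal_of_isIntegral
    (S := integralClosure Λ F) (IsLocalRing.maximalIdeal Λ) (by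
      rw [(RingHom.injective_iff_ker_eq_bot _).1 hinj']; exact bot_le)
  have hQm : ∀ x ∈ IsLocalRing.maximalIdeal Λ, algebraMap Λ (integralClosure Λ F) x ∈ Q := by
    intro x hx
    rwa [← Ideal.mem_comap, hQc]
  let w : HeightOneSpectrum (integralClosure Λ F) :=
    { asIdeal := Q
      isPrime := hQ.isPrime
      ne_bot := by
        rintro rfl
        obtain ⟨π, hπ⟩ := IsDiscreteValuationRing.exists_irreducible Λ
        have h1 : π ∈ IsLocalRing.maximalIdeal Λ := by
          rw [hπ.maximalIdeal_eq]; exact Ideal.mem_span_singleton_self π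
        have h2 := hQm π h1
        rw [Ideal.mem_bot] at h2
        exact hπ.ne_zero (hinj' (h2.trans (map_zero _).symm)) }
  have hb : (1 : NNReal) < 2 := one_lt_two
  obtain ⟨n, hn⟩ := hfin.fg_top
  have hle : ∀ x : integralClosure Λ F, w.adicAbv hb (x : F) ≤ 1 := fun x => by
    have h1 := w.adicAbv_of_algebraMap (K := F) hb x
    exact h1.le.trans (w.intAdicAbv_le_one hb x)
  refine ⟨w.adicAbv hb, w.isNonarchimedean_adicAbv hb, fun x => hle (algebraMap Λ _ x),
    fun x hx => ?_, n.image Subtype.val, ?_, ?_⟩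
  · have h1 := w.adicAbv_of_algebraMap (K := F) hb (algebraMap Λ _ x)
    exact h1.trans_lt ((w.intAdicAbv_lt_one_iff hb _).2 (hQm x hx))
  · intro x hx
    obtain ⟨y, -, rfl⟩ := Finset.mem_image.1 hx
    exact hle y
  · intro O hΛ hnO hinv
    have hN : ∀ x : integralClosure Λ F, (x : F) ∈ O := by
      intro x
      have hx : x ∈ Submodule.span Λ (n : Set (integralClosure Λ F)) := hn ▸ Submodule.mem_top
      induction hx using Submodule.span_induction with
      | mem x hx => exact hnO _ (Finset.mem_image_of_mem _ hx)
      | zero => exact O.zero_mem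
      | add x y _ _ hx hy => exact O.add_mem hx hy
      | smul a x _ hx =>
        rw [Subalgebra.coe_smul, Algebra.smul_def]
        exact O.mul_mem (hΛ a) hx
    intro x hx
    have hx' : w.valuation F x ≤ 1 := (WithZeroMulInt.toNNReal_le_one_iff hb).1 hx
    obtain ⟨a, s, hs⟩ := w.exists_primeCompl_mul_eq_of_integer x hx'
    have h1 : w.adicAbv hb ((s : integralClosure Λ F) : F) = 1 :=
      (w.adicAbv_of_algebraMap (K := F) hb s).trans ((w.intAdicAbv_eq_one_iff hb _).2 s.2)
    have h2 : ((s : integralClosure Λ F) : F) ≠ 0 := by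
      intro h0
      rw [h0, map_zero] at h1
      exact zero_ne_one h1
    have h3 : x = a * ((s : integralClosure Λ F) : F)⁻¹ := by
      rw [eq_mul_inv_iff_mul_eq₀ h2]; exact hs
    rw [h3]
    exact O.mul_mem (hN a) (hinv _ (hN s) h1)

end Valuation

section Valuation

/-- The extension of a discrete valuation to a field generated by finitely many algebraic
elements. -/
lemma exists_absoluteValue_of_isAlgebraic (Λ : Type*) {F : Type*} [CommRing Λ] [IsDomain Λ]
    [IsDiscreteValuationRing Λ] [Field F] [CharZero F] [Algebra Λ F] [FaithfulSMul Λ F]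
    {S : Set F} (hSfin : S.Finite) (hS : ∀ L : Subfield F, S ⊆ L → L = ⊤)
    (halg : ∀ L : Subfield F, (∀ x : Λ, algebraMap Λ F x ∈ L) → ∀ a ∈ S, IsAlgebraic L a) :
    ∃ v : AbsoluteValue F ℝ, IsNonarchimedean v ∧ (∀ x : Λ, v (algebraMap Λ F x) ≤ 1) ∧
      (∀ x ∈ IsLocalRing.maximalIdeal Λ, v (algebraMap Λ F x) < 1) ∧
      ∃ n : Finset F, (∀ x ∈ n, v x ≤ 1) ∧ ∀ O : Subring F,
        (∀ x : Λ, algebraMap Λ F x ∈ O) → (∀ x ∈ n, x ∈ O) → (∀ x ∈ O, v x = 1 → x⁻¹ ∈ O) →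
        ∀ x, v x ≤ 1 → x ∈ O := by
  let _ : Algebra (FractionRing Λ) F := FractionRing.liftAlgebra Λ F
  have hK : CharZero (FractionRing Λ) := by
    have : Function.Injective (Nat.cast : ℕ → F) := Nat.cast_injective
    refine ⟨fun a b hab => this ?_⟩
    simpa using congrArg (algebraMap (FractionRing Λ) F) hab
  have hfd : FiniteDimensional (FractionRing Λ) F := by
    have hSi : ∀ x ∈ S, IsIntegral (FractionRing Λ) x := by
      intro x hx
      have h1 := halg (algebraMap (FractionRing Λ) F).fieldRange (fun y =>
        ⟨algebraMap Λ _ y, (IsScalarTower.algebraMap_apply Λ (FractionRing Λ) F y).symm⟩) x hx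
      refine IsAlgebraic.isIntegral ?_
      refine IsAlgebraic.of_ringHom_of_comp_eq
        (algebraMap (FractionRing Λ) F).rangeRestrictField (RingHom.id F) h1
        (algebraMap (FractionRing Λ) F).rangeRestrictField_bijective.2
        Function.injective_id rfl
    have := hSfin.to_subtype
    have h2 := IntermediateField.finiteDimensional_adjoin hSi
    have h3 : IntermediateField.adjoin (FractionRing Λ) S = ⊤ := by
      have := hS (IntermediateField.adjoin (FractionRing Λ) S).toSubfield
        (IntermediateField.subset_adjoin _ _)
      exact IntermediateField.toSubfield_injective this
    rw [h3] at h2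
    exact Module.Finite.equiv (IntermediateField.topEquiv (F := FractionRing Λ) (E := F)).toLinearEquiv
  exact exists_absoluteValue_of_isDiscreteValuationRing Λ (FractionRing Λ) F

/-- A Gauss valuation on `ℚ(u)` extended to a finite extension `F`. -/
lemma exists_absoluteValue_of_algebraicIndependent {ι F : Type*} [Finite ι] [Field F] [CharZero F]
    {u : ι → F} (hu : AlgebraicIndependent ℤ u) {S : Set F} (hSfin : S.Finite)
    (hS : ∀ L : Subfield F, S ⊆ L → L = ⊤)
    (halg : ∀ L : Subfield F, (∀ i, u i ∈ L) → ∀ a ∈ S, IsAlgebraic L a)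
    {p : ℕ} (hp : p.Prime) :
    ∃ v : AbsoluteValue F ℝ, IsNonarchimedean v ∧ v p < 1 ∧ (∀ i, v (u i) ≤ 1) ∧
      ∃ n : Finset F, (∀ x ∈ n, v x ≤ 1) ∧ ∀ O : Subring F,
        (∀ i, u i ∈ O) → (∀ x ∈ n, x ∈ O) → (∀ x ∈ O, v x = 1 → x⁻¹ ∈ O) →
        ∀ x, v x ≤ 1 → x ∈ O := by
  classical
  let I : Ideal (MvPolynomial ι ℤ) := Ideal.span {MvPolynomial.C (p : ℤ)}
  have hpr : Prime (MvPolynomial.C (p : ℤ) : MvPolynomial ι ℤ) :=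
    (MvPolynomial.prime_C_iff ι).2 (Nat.prime_iff_prime_int.1 hp)
  have hI : I.IsPrime := (Ideal.span_singleton_prime hpr.ne_zero).2 hpr
  let Λ := Localization.AtPrime I
  have hdom : IsDomain Λ := IsLocalization.isDomain_localization I.primeCompl_le_nonZeroDivisors
  have hnoeth : IsNoetherianRing Λ := IsLocalization.isNoetherianRing I.primeCompl Λ inferInstance
  have hmax : IsLocalRing.maximalIdeal Λ =
      Ideal.span {algebraMap (MvPolynomial ι ℤ) Λ (MvPolynomial.C (p : ℤ))} := by
    rw [← Localization.AtPrime.map_eq_maximalIdeal, Ideal.map_span, Set.image_singleton]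
  have hinjΛ : Function.Injective (algebraMap (MvPolynomial ι ℤ) Λ) :=
    IsLocalization.injective Λ I.primeCompl_le_nonZeroDivisors
  have hnf : ¬ IsField Λ := by
    rw [IsLocalRing.isField_iff_maximalIdeal_eq, hmax, Ideal.span_singleton_eq_bot]
    exact fun h => hpr.ne_zero (hinjΛ (h.trans (map_zero _).symm))
  have hprin : (IsLocalRing.maximalIdeal Λ).IsPrincipal := ⟨⟨_, hmax⟩⟩
  have hdvr : IsDiscreteValuationRing Λ :=
    ((IsDiscreteValuationRing.TFAE Λ hnf).out 0 4 :
      IsDiscreteValuationRing Λ ↔ (IsLocalRing.maximalIdeal Λ).IsPrincipal).2 hprin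
  have hunit : ∀ y : I.primeCompl, IsUnit ((MvPolynomial.aeval u : _ →ₐ[ℤ] F).toRingHom y) := by
    intro y
    rw [isUnit_iff_ne_zero]
    intro h
    have h1 : (y : MvPolynomial ι ℤ) = 0 := hu (h.trans (map_zero _).symm)
    exact y.2 (h1 ▸ I.zero_mem)
  let φ : Λ →+* F := IsLocalization.lift hunit
  have hφinj : Function.Injective φ := by
    refine (IsLocalization.lift_injective_iff hunit).2 fun x y => ?_
    rw [hinjΛ.eq_iff]
    exact hu.eq_iff.symm
  have hφ : ∀ f, φ (algebraMap _ Λ f) = MvPolynomial.aeval u f := fun f =>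
    IsLocalization.lift_eq hunit f
  let _ : Algebra Λ F := φ.toAlgebra
  have hfaith : FaithfulSMul Λ F := (faithfulSMul_iff_algebraMap_injective Λ F).2 hφinj
  obtain ⟨v, hv, hle, hlt, n, hn, hO⟩ :=
    exists_absoluteValue_of_isAlgebraic Λ hSfin hS fun L hL => halg L fun i => by
      have h1 := hL (algebraMap (MvPolynomial ι ℤ) Λ (MvPolynomial.X i))
      change φ _ ∈ L at h1
      rwa [hφ, MvPolynomial.aeval_X] at h1
  refine ⟨v, hv, ?_, fun i => ?_, n, hn, fun O huO hnO hinv => hO O (fun x => ?_) hnO hinv⟩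
  · have h1 := hlt (algebraMap (MvPolynomial ι ℤ) Λ (MvPolynomial.C (p : ℤ)))
      (by rw [hmax]; exact Ideal.mem_span_singleton_self _)
    change v (φ _) < 1 at h1
    rw [hφ] at h1
    simpa using h1
  · have h1 := hle (algebraMap (MvPolynomial ι ℤ) Λ (MvPolynomial.X i))
    change v (φ _) ≤ 1 at h1
    rw [hφ] at h1
    simpa using h1
  · have hP : ∀ f : MvPolynomial ι ℤ, MvPolynomial.aeval u f ∈ O := by
      intro f
      induction f using MvPolynomial.induction_on with
      | C a => simp
      | add f g hf hg => rw [map_add]; exact O.add_mem hf hg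
      | mul_X f i hf => rw [map_mul, MvPolynomial.aeval_X]; exact O.mul_mem hf (huO i)
    obtain ⟨f, g, rfl⟩ := IsLocalization.exists_mk'_eq I.primeCompl x
    have h1 : φ (IsLocalization.mk' Λ f g) * MvPolynomial.aeval u (g : MvPolynomial ι ℤ) =
        MvPolynomial.aeval u f := by
      rw [← hφ, ← hφ, ← map_mul, IsLocalization.mk'_spec]
    have h2 : v (MvPolynomial.aeval u (g : MvPolynomial ι ℤ)) = 1 := by
      have h3 : v (φ (algebraMap _ Λ (g : MvPolynomial ι ℤ))) * v (φ (IsLocalization.mk' Λ 1 g)) = 1 := by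
        rw [← map_mul, ← map_mul, IsLocalization.mk'_spec']
        simp
      have h4 : v (φ (algebraMap _ Λ (g : MvPolynomial ι ℤ))) ≤ 1 := hle _
      have h5 : v (φ (IsLocalization.mk' Λ 1 g)) ≤ 1 := hle _
      rw [← hφ]
      nlinarith [v.nonneg (φ (algebraMap _ Λ (g : MvPolynomial ι ℤ))),
        v.nonneg (φ (IsLocalization.mk' Λ 1 g))]
    have h6 : MvPolynomial.aeval u (g : MvPolynomial ι ℤ) ≠ 0 := by
      intro h0
      rw [h0, map_zero] at h2
      exact zero_ne_one h2
    change φ _ ∈ O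
    rw [(eq_mul_inv_iff_mul_eq₀ h6).2 h1]
    exact O.mul_mem (hP f) (hinv _ (hP g) h2)

end Valuation

section Finiteness

open MvPolynomial

/-- A field which is the fraction field of a finitely generated ring has a transcendence basis
among the generators such that the generators become integral after inverting one element. -/
lemma exists_integral_presentation {F : Type*} [Field F] [CharZero F] {S : Set F} (hS : S.Finite)
    (hfrac : ∀ x : F, ∃ a ∈ Subring.closure S, ∃ b ∈ Subring.closure S, b ≠ 0 ∧ x = a / b) :
    ∃ T ⊆ S, ∃ Y : MvPolynomial T ℤ, Y ≠ 0 ∧ AlgebraicIndependent ℤ (Subtype.val : T → F) ∧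
      ∀ a ∈ S, (aeval (Subtype.val : T → F) : _ →ₐ[ℤ] F).toRingHom.IsIntegralElem
        (aeval (Subtype.val : T → F) Y * a) := by
  classical
  have hcl : ∀ x ∈ Subring.closure S, x ∈ Algebra.adjoin ℤ S := fun x hx => by
    have : Subring.closure S ≤ (Algebra.adjoin ℤ S).toSubring :=
      Subring.closure_le.2 Algebra.subset_adjoin
    exact this hx
  have halg : Algebra.IsAlgebraic (Algebra.adjoin ℤ S) F := by
    refine ⟨fun x => ?_⟩
    obtain ⟨a, ha, b, hb, hb0, rfl⟩ := hfrac x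
    have h1 := isAlgebraic_algebraMap (A := F) (⟨a, hcl a ha⟩ : Algebra.adjoin ℤ S)
    have h2 := isAlgebraic_algebraMap (A := F) (⟨b, hcl b hb⟩ : Algebra.adjoin ℤ S)
    rw [div_eq_mul_inv]
    exact h1.mul h2.inv
  obtain ⟨T, hTS, hT⟩ := exists_isTranscendenceBasis_subset (R := ℤ) S
  have hTalg := hT.isAlgebraic
  have hex : ∀ a : F, ∃ Y : MvPolynomial T ℤ, Y ≠ 0 ∧
      (aeval (Subtype.val : T → F) : _ →ₐ[ℤ] F).toRingHom.IsIntegralElem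
        (aeval (Subtype.val : T → F) Y * a) := by
    intro a
    obtain ⟨y, hy0, P, hP, hPa⟩ := (hTalg.isAlgebraic a).exists_integral_multiple
    let e := hT.1.aevalEquiv
    refine ⟨e.symm y, by simpa using hy0, P.map e.symm.toRingEquiv.toRingHom, hP.map _, ?_⟩
    have he : ∀ z, aeval (Subtype.val : T → F) (e.symm z) = z := fun z => by
      rw [← hT.1.algebraMap_aevalEquiv, AlgEquiv.apply_symm_apply]; rfl
    rw [Polynomial.eval₂_map, he]
    have hcomp : (aeval (Subtype.val : T → F) : _ →ₐ[ℤ] F).toRingHom.comp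
        e.symm.toRingEquiv.toRingHom = algebraMap _ F := RingHom.ext fun z => he z
    rw [hcomp]
    exact hPa
  choose Y hY0 hY using hex
  have hint : ∀ f, (aeval (Subtype.val : T → F) : _ →ₐ[ℤ] F).toRingHom.IsIntegralElem
        (aeval (Subtype.val : T → F) f) := fun f => RingHom.isIntegralElem_map _
  refine ⟨T, hTS, ∏ a ∈ hS.toFinset, Y a, Finset.prod_ne_zero_iff.2 fun a _ => hY0 a, hT.1, ?_⟩
  intro a ha
  rw [← Finset.prod_erase_mul _ _ (hS.mem_toFinset.2 ha), map_mul, mul_assoc]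
  exact (hint _).mul _ (hY a)

/-- A finiteness criterion for finitely generated rings. -/
lemma finite_of_isIntegralElem {R ι : Type*} [CommRing R] {S : Set R} (hS : S.Finite)
    (htop : Subring.closure S = ⊤) (t : ι → R) (c : ι → ℤ) {p j : ℕ} (hp : p.Prime)
    (hpj : (p : R) ^ j = 0) (ht : ∀ i, IsNilpotent (t i - c i)) (Y : MvPolynomial ι ℤ)
    (hY : ¬ (p : ℤ) ∣ eval c Y)
    (hint : ∀ a ∈ S, (aeval t : _ →ₐ[ℤ] R).toRingHom.IsIntegralElem (aeval t Y * a)) :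
    Finite R := by
  let C := integralClosure ℤ R
  have htC : ∀ i, IsIntegral ℤ (t i) := fun i => by
    obtain ⟨n, hn⟩ := ht i
    have h1 : IsIntegral ℤ (t i - c i) := by
      refine IsIntegral.of_pow (n := n + 1) n.succ_pos ?_
      rw [pow_succ, hn, zero_mul]
      exact isIntegral_zero
    have h2 : IsIntegral ℤ (c i : R) := isIntegral_algebraMap (R := ℤ) (x := c i)
    simpa using h1.add h2
  let tC : ι → C := fun i => ⟨t i, htC i⟩
  have hval : ∀ f : MvPolynomial ι ℤ, ((aeval tC f : C) : R) = aeval t f := fun f =>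
    (MvPolynomial.aeval_algebraMap_apply R tC f).symm
  have hnil : IsNilpotent (aeval tC Y - (eval c Y : ℤ)) := by
    rw [← mem_nilradical, ← Ideal.Quotient.eq_zero_iff_mem, map_sub, sub_eq_zero]
    have h1 : ∀ i, Ideal.Quotient.mk (nilradical C) (tC i) = c i := fun i => by
      rw [← sub_eq_zero, ← map_intCast (Ideal.Quotient.mk (nilradical C)), ← map_sub,
        Ideal.Quotient.eq_zero_iff_mem, mem_nilradical]
      obtain ⟨n, hn⟩ := ht i
      exact ⟨n, Subtype.ext (by simpa [tC] using hn)⟩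
    have h2 : (Ideal.Quotient.mk (nilradical C)).comp (aeval tC : _ →ₐ[ℤ] C).toRingHom =
        ((Ideal.Quotient.mk (nilradical C)).comp (Int.castRingHom C)).comp (eval c) :=
      MvPolynomial.ringHom_ext (by simp) fun i => by simpa using h1 i
    exact RingHom.congr_fun h2 Y
  have hunit : IsUnit (aeval tC Y) := by
    have h1 : IsUnit ((eval c Y : ℤ) : C) := by
      have h2 : IsCoprime (eval c Y) ((p : ℤ) ^ j) := by
        refine (IsCoprime.pow_left ?_).symm
        exact ((Nat.prime_iff_prime_int.1 hp).coprime_iff_not_dvd).2 hY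
      obtain ⟨a, b, hab⟩ := h2
      have h3 : ((a * eval c Y + b * p ^ j : ℤ) : C) = 1 := by rw [hab, Int.cast_one]
      have h4 : (p : C) ^ j = 0 := Subtype.ext (by simpa using hpj)
      push_cast at h3
      rw [h4, mul_zero, add_zero] at h3
      exact IsUnit.of_mul_eq_one_right _ h3
    have := hnil.isUnit_add_left_of_commute h1 (Commute.all _ _)
    simpa using this
  have hSC : ∀ a ∈ S, IsIntegral ℤ a := by
    intro a ha
    obtain ⟨P, hP, hPa⟩ := hint a ha
    have h1 : IsIntegral C (aeval t Y * a) := by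
      refine ⟨P.map (aeval tC : _ →ₐ[ℤ] C).toRingHom, hP.map _, ?_⟩
      rw [Polynomial.eval₂_map]
      have hcomp : (algebraMap C R).comp (aeval tC : _ →ₐ[ℤ] C).toRingHom =
          (aeval t : _ →ₐ[ℤ] R).toRingHom := RingHom.ext hval
      rw [hcomp]
      exact hPa
    have h2 : IsIntegral ℤ (aeval t Y * a) := isIntegral_trans _ h1
    obtain ⟨z, hz⟩ := hunit.exists_left_inv
    have h3 : (z : R) * aeval t Y = 1 := by
      rw [← hval]; exact congrArg Subtype.val hz
    have h4 : a = z * (aeval t Y * a) := by rw [← mul_assoc, h3, one_mul]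
    rw [h4]
    exact z.2.mul h2
  have hfin := Algebra.finite_adjoin_of_finite_of_isIntegral hS hSC
  have htop' : Algebra.adjoin ℤ S = ⊤ := by
    rw [eq_top_iff]
    intro x _
    have : Subring.closure S ≤ (Algebra.adjoin ℤ S).toSubring :=
      Subring.closure_le.2 Algebra.subset_adjoin
    exact this (htop ▸ Subring.mem_top x)
  rw [htop'] at hfin
  have hfin' : Module.Finite ℤ R := Module.Finite.equiv Subalgebra.topEquiv.toLinearEquiv
  refine Module.finite_of_fg_torsion R ?_
  intro x
  refine ⟨⟨(p : ℤ) ^ j, mem_nonZeroDivisors_of_ne_zero (pow_ne_zero _ (by exact_mod_cast hp.ne_zero))⟩, ?_⟩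
  change ((p : ℤ) ^ j) • x = 0
  rw [zsmul_eq_mul]
  push_cast
  rw [hpj, zero_mul]

end Finiteness

section AbsoluteValue

variable {F : Type*} [Field F] {v : AbsoluteValue F ℝ}

namespace IsNonarchimedean

lemma map_add_le_of_le (hv : IsNonarchimedean v) {x y : F} {r : ℝ} (hx : v x ≤ r) (hy : v y ≤ r) :
    v (x + y) ≤ r := (hv x y).trans (max_le hx hy)

lemma map_sub_le_of_le (hv : IsNonarchimedean v) {x y : F} {r : ℝ} (hx : v x ≤ r) (hy : v y ≤ r) :
    v (x - y) ≤ r := by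
  rw [sub_eq_add_neg]
  exact map_add_le_of_le hv hx ((v.map_neg y).trans_le hy)

/-- The unit ball of a nonarchimedean absolute value. -/
def unitBall (hv : IsNonarchimedean v) : ValuationSubring F where
  carrier := {x | v x ≤ 1}
  mul_mem' {x y} hx hy := by
    rw [Set.mem_ofPred_eq, map_mul]
    exact mul_le_one₀ hx (v.nonneg y) hy
  one_mem' := v.map_one.le
  add_mem' := hv.map_add_le_of_le
  zero_mem' := v.map_zero.trans_le zero_le_one
  neg_mem' {x} hx := (v.map_neg x).trans_le hx
  mem_or_inv_mem' x := by
    simp only [Set.mem_ofPred_eq, map_inv₀]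
    rcases le_total (v x) 1 with h | h
    · exact Or.inl h
    · exact Or.inr (inv_le_one_of_one_le₀ h)

lemma le_one_of_isIntegralElem (hv : IsNonarchimedean v) {R : Type*} [CommRing R] {φ : R →+* F}
    (hφ : ∀ r, v (φ r) ≤ 1) {x : F} (hx : φ.IsIntegralElem x) : v x ≤ 1 := by
  obtain ⟨P, hP, hPx⟩ := hx
  have h1 : IsIntegral hv.unitBall x := by
    refine ⟨P.map (φ.codRestrict hv.unitBall hφ), hP.map _, ?_⟩
    rw [Polynomial.eval₂_map]
    exact hPx
  obtain ⟨y, rfl⟩ := IsIntegrallyClosed.isIntegral_iff.1 h1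
  exact y.2

lemma le_one_of_mem_closure (hv : IsNonarchimedean v) {S : Set F} (hS : ∀ x ∈ S, v x ≤ 1) {x : F}
    (hx : x ∈ Subring.closure S) : v x ≤ 1 := by
  have h : Subring.closure S ≤ hv.unitBall.toSubring := Subring.closure_le.2 hS
  exact h hx

lemma intCast_eq_one (hv : IsNonarchimedean v) {p : ℕ} (hp : p.Prime) (hp1 : v p < 1) {e : ℤ}
    (he : ¬ (p : ℤ) ∣ e) : v e = 1 := by
  refine le_antisymm hv.apply_intCast_le_one (not_lt.1 fun hlt => ?_)
  obtain ⟨a, b, hab⟩ := (Nat.prime_iff_prime_int.1 hp).coprime_iff_not_dvd.2 he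
  have h1 : v (a * p + b * e : F) = 1 := by
    rw [← v.map_one, ← Int.cast_one, ← hab]; push_cast; rfl
  have h2 : v (a * p : F) < 1 := by
    rw [map_mul]
    exact mul_lt_one_of_nonneg_of_lt_one_right hv.apply_intCast_le_one (v.nonneg _) hp1
  have h3 : v (b * e : F) < 1 := by
    rw [map_mul]
    exact mul_lt_one_of_nonneg_of_lt_one_right hv.apply_intCast_le_one (v.nonneg _) hlt
  exact absurd h1 ((hv _ _).trans_lt (max_lt h2 h3)).ne

end IsNonarchimedean

end AbsoluteValue

section Model

open MvPolynomial

lemma AlgebraicIndependent.sub_div {ι F : Type*} [Field F] [CharZero F] {t : ι → F}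
    (ht : AlgebraicIndependent ℤ t) (c : ι → ℤ) {p : ℕ} (hp : p ≠ 0) :
    AlgebraicIndependent ℤ fun i => (t i - c i) / p := by
  have hp' : (p : F) ≠ 0 := Nat.cast_ne_zero.2 hp
  let ψ : MvPolynomial ι ℤ →ₐ[ℤ] MvPolynomial ι ℤ := aeval fun i => C (p : ℤ) * X i + C (c i)
  have hψ : ∀ f, aeval (fun i => (t i - c i) / p) (ψ f) = aeval t f := by
    intro f
    have : (aeval (fun i => (t i - c i) / p) : _ →ₐ[ℤ] F).comp ψ = aeval t := by
      ext i
      simp [ψ, mul_div_cancel₀ _ hp']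
    exact DFunLike.congr_fun this f
  have hex : ∀ g, ∃ (N : ℕ) (f : MvPolynomial ι ℤ), C (p : ℤ) ^ N * g = ψ f := by
    intro g
    induction g using MvPolynomial.induction_on with
    | C a => exact ⟨0, C a, by simp [ψ]⟩
    | add g h hg hh =>
      obtain ⟨N, f, hf⟩ := hg
      obtain ⟨M, e, he⟩ := hh
      refine ⟨N + M, C (p : ℤ) ^ M * f + C (p : ℤ) ^ N * e, ?_⟩
      have hC : ψ (C (p : ℤ)) = C (p : ℤ) := by simp [ψ]
      rw [map_add, map_mul, map_mul, map_pow, map_pow, hC, ← hf, ← he]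
      ring
    | mul_X g i hg =>
      obtain ⟨N, f, hf⟩ := hg
      refine ⟨N + 1, f * (X i - C (c i)), ?_⟩
      have hC : ψ (X i - C (c i)) = C (p : ℤ) * X i := by simp [ψ]
      rw [map_mul, hC, ← hf]
      ring
  rw [algebraicIndependent_iff]
  intro g hg
  obtain ⟨N, f, hf⟩ := hex g
  have h1 : aeval t f = 0 := by rw [← hψ, ← hf, map_mul, hg, mul_zero]
  have h2 := (algebraicIndependent_iff.1 ht) f h1
  rw [h2, map_zero] at hf
  refine (mul_eq_zero.1 hf).resolve_left (pow_ne_zero _ ?_)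
  rw [Ne, C_eq_zero]
  exact_mod_cast hp

/-- Construction of an absolute value which is at most one on a finitely generated ring. -/
lemma exists_absoluteValue_of_presentation {F : Type*} [Field F] [CharZero F] {S T : Set F}
    (hS : S.Finite) (hTS : T ⊆ S)
    (hfrac : ∀ x : F, ∃ a ∈ Subring.closure S, ∃ b ∈ Subring.closure S, b ≠ 0 ∧ x = a / b)
    {Y : MvPolynomial T ℤ} (hY0 : Y ≠ 0) (hT : AlgebraicIndependent ℤ (Subtype.val : T → F))
    (hint : ∀ a ∈ S, (aeval (Subtype.val : T → F) : _ →ₐ[ℤ] F).toRingHom.IsIntegralElem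
        (aeval (Subtype.val : T → F) Y * a)) :
    ∃ (p : ℕ) (c : T → ℤ) (v : AbsoluteValue F ℝ), p.Prime ∧ ¬ (p : ℤ) ∣ eval c Y ∧
      IsNonarchimedean v ∧ v p < 1 ∧ (∀ i : T, v (i - c i) ≤ v p) ∧
      (∀ x ∈ Subring.closure S, v x ≤ 1) ∧ ∃ n : Finset F, (∀ x ∈ n, v x ≤ 1) ∧
      ∀ O : Subring F, (∀ i : T, ((i : F) - c i) / p ∈ O) → (∀ x ∈ n, x ∈ O) →
        (∀ x ∈ O, v x = 1 → x⁻¹ ∈ O) → ∀ x, v x ≤ 1 → x ∈ O := by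
  have hTfin : Finite T := (hS.subset hTS).to_subtype
  obtain ⟨c, hc⟩ : ∃ c : T → ℤ, eval c Y ≠ 0 := by
    by_contra! h
    exact hY0 (MvPolynomial.funext fun c => by rw [h, map_zero])
  obtain ⟨p, hpc, hp⟩ := Nat.exists_infinite_primes ((eval c Y).natAbs + 1)
  have hpY : ¬ (p : ℤ) ∣ eval c Y := fun h => by
    have := Nat.le_of_dvd (Int.natAbs_pos.2 hc) (Int.natCast_dvd.1 h)
    omega
  have hp' : (p : F) ≠ 0 := Nat.cast_ne_zero.2 hp.ne_zero
  have hY : aeval (Subtype.val : T → F) Y ≠ 0 := fun h => hY0 (hT (h.trans (map_zero _).symm))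
  obtain ⟨v, hv, hp1, hu1, n, hn, hO⟩ := exists_absoluteValue_of_algebraicIndependent
    (hT.sub_div c hp.ne_zero) hS (fun L hL => by
      have hle : Subring.closure S ≤ L.toSubring := Subring.closure_le.2 hL
      rw [eq_top_iff]
      intro x _
      obtain ⟨a, ha, b, hb, -, rfl⟩ := hfrac x
      exact L.div_mem (hle ha) (hle hb)) (fun L hL a ha => by
      have htL : ∀ i : T, (i : F) ∈ L := fun i => by
        have h1 := L.add_mem (L.mul_mem (hL i) (natCast_mem L p)) (intCast_mem L (c i))
        rwa [div_mul_cancel₀ _ hp', sub_add_cancel] at h1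
      have hLY : ∀ f : MvPolynomial T ℤ, aeval (Subtype.val : T → F) f ∈ L := fun f => by
        induction f using MvPolynomial.induction_on with
        | C a => simp
        | add f g hf hg => rw [map_add]; exact L.add_mem hf hg
        | mul_X f i hf => rw [map_mul, aeval_X]; exact L.mul_mem hf (htL i)
      obtain ⟨P, hP, hPa⟩ := hint a ha
      have h1 : IsIntegral L (aeval (Subtype.val : T → F) Y * a) := by
        refine ⟨P.map ((aeval (Subtype.val : T → F) : _ →ₐ[ℤ] F).toRingHom.codRestrict L hLY),
          hP.map _, ?_⟩
        rw [Polynomial.eval₂_map]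
        exact hPa
      have h2 : IsAlgebraic L (aeval (Subtype.val : T → F) Y)⁻¹ :=
        isAlgebraic_algebraMap (A := F) (⟨_, L.inv_mem (hLY Y)⟩ : L)
      have h3 := h2.mul h1.isAlgebraic
      rwa [inv_mul_cancel_left₀ hY] at h3) hp
  have hu : ∀ i : T, v (i - c i) ≤ v p := fun i => by
    have h1 := hu1 i
    rwa [map_div₀, div_le_one (v.pos hp')] at h1
  have ht : ∀ i : T, v i ≤ 1 := fun i => by
    have := hv.map_add_le_of_le ((hu i).trans hp1.le) (hv.apply_intCast_le_one (n := c i))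
    rwa [sub_add_cancel] at this
  have hcomp : ∀ f : MvPolynomial T ℤ, v (aeval (Subtype.val : T → F) f - eval c f) ≤ v p := by
    intro f
    induction f using MvPolynomial.induction_on with
    | C a => simp [v.nonneg]
    | add f g hf hg =>
      have := hv.map_add_le_of_le hf hg
      convert this using 2
      rw [map_add, map_add]; push_cast; ring
    | mul_X f i hf =>
      have h1 : v ((aeval (Subtype.val : T → F) f - eval c f) * i) ≤ v p := by
        rw [map_mul]
        exact mul_le_of_le_one_right (v.nonneg _) (ht i) |>.trans hf
      have h2 : v ((eval c f : ℤ) * (i - c i) : F) ≤ v p := by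
        rw [map_mul]
        exact mul_le_of_le_one_left (v.nonneg _) hv.apply_intCast_le_one |>.trans (hu i)
      have := hv.map_add_le_of_le h1 h2
      convert this using 2
      rw [map_mul, map_mul, aeval_X, eval_X]; push_cast; ring
  have hS1 : ∀ f : MvPolynomial T ℤ, v (aeval (Subtype.val : T → F) f) ≤ 1 := fun f => by
    have := hv.map_add_le_of_le ((hcomp f).trans hp1.le) (hv.apply_intCast_le_one (n := eval c f))
    rwa [sub_add_cancel] at this
  have hvY : 1 ≤ v (aeval (Subtype.val : T → F) Y) := by
    by_contra! hlt
    have h1 := hv (aeval (Subtype.val : T → F) Y) (-(aeval (Subtype.val : T → F) Y - eval c Y))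
    rw [v.map_neg, show aeval (Subtype.val : T → F) Y + -(aeval (Subtype.val : T → F) Y - eval c Y)
      = (eval c Y : ℤ) by ring, hv.intCast_eq_one hp hp1 hpY] at h1
    exact absurd h1 (not_le.2 (max_lt hlt ((hcomp Y).trans_lt hp1)))
  refine ⟨p, c, v, hp, hpY, hv, hp1, hu, fun x hx => hv.le_one_of_mem_closure (fun a ha => ?_) hx,
    n, hn, hO⟩
  have h1 := hv.le_one_of_isIntegralElem hS1 (hint a ha)
  rw [map_mul] at h1
  exact (le_mul_of_one_le_left (v.nonneg _) hvY).trans h1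

end Model

section Congruence

variable {F : Type*} [Field F] {v : AbsoluteValue F ℝ}

namespace IsNonarchimedean

lemma map_eq_of_sub_lt (hv : IsNonarchimedean v) {x y : F} (h : v (x - y) < v y) : v x = v y := by
  have h1 := hv.add_eq_max_of_ne h.ne
  rwa [sub_add_cancel, max_eq_right h.le] at h1

lemma map_div_sub_div_le (hv : IsNonarchimedean v) (σ : F ≃+* F) {x y : F} {δ : ℝ}
    (hx : v x ≤ 1) (hy : v y ≤ 1) (hσx : v (σ x - x) ≤ δ) (hσy : v (σ y - y) ≤ δ) (hδ : δ < v y) :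
    v (σ (x / y) - x / y) ≤ δ / v y ^ 2 := by
  have hvy : v (σ y) = v y := hv.map_eq_of_sub_lt (hσy.trans_lt hδ)
  have hδ0 : 0 ≤ δ := (v.nonneg _).trans hσx
  have hpos : 0 < v y := hδ0.trans_lt hδ
  have hy0 : y ≠ 0 := (v.pos_iff).1 hpos
  have hσy0 : σ y ≠ 0 := (v.pos_iff).1 (hvy ▸ hpos)
  have h1 : σ (x / y) - x / y = (y * (σ x - x) - x * (σ y - y)) / (y * σ y) := by
    rw [map_div₀]
    field_simp
    ring
  rw [h1, map_div₀, map_mul, hvy, ← sq]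
  refine div_le_div_of_nonneg_right (hv.map_sub_le_of_le ?_ ?_) (sq_nonneg _)
  · rw [map_mul]
    exact (mul_le_of_le_one_left (v.nonneg _) hy).trans hσx
  · rw [map_mul]
    exact (mul_le_of_le_one_left (v.nonneg _) hx).trans hσy

/-- The elements of the unit ball which are nearly fixed by a field automorphism. -/
def nearSubring (hv : IsNonarchimedean v) (σ : F ≃+* F) {ε : ℝ} (hε0 : 0 ≤ ε) (hε1 : ε ≤ 1) :
    Subring F where
  carrier := {x | v x ≤ 1 ∧ v (σ x - x) ≤ ε}
  mul_mem' := by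
    rintro x y ⟨hx, hσx⟩ ⟨hy, hσy⟩
    have h1 : v (σ x) ≤ 1 := by
      have := hv.map_add_le_of_le (hσx.trans hε1) hx
      rwa [sub_add_cancel] at this
    refine ⟨?_, ?_⟩
    · rw [map_mul]
      exact mul_le_one₀ hx (v.nonneg y) hy
    · rw [map_mul, show σ x * σ y - x * y = σ x * (σ y - y) + (σ x - x) * y by ring]
      refine hv.map_add_le_of_le ?_ ?_
      · rw [map_mul]
        exact (mul_le_of_le_one_left (v.nonneg _) h1).trans hσy
      · rw [map_mul]
        exact (mul_le_of_le_one_right (v.nonneg _) hy).trans hσx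
  one_mem' := by simp [hε0]
  add_mem' := by
    rintro x y ⟨hx, hσx⟩ ⟨hy, hσy⟩
    refine ⟨hv.map_add_le_of_le hx hy, ?_⟩
    rw [map_add, add_sub_add_comm]
    exact hv.map_add_le_of_le hσx hσy
  zero_mem' := by simp [hε0]
  neg_mem' := by
    rintro x ⟨hx, hσx⟩
    refine ⟨(v.map_neg x).trans_le hx, ?_⟩
    rw [map_neg, ← neg_sub', v.map_neg]
    exact hσx

lemma inv_mem_nearSubring (hv : IsNonarchimedean v) (σ : F ≃+* F) {ε : ℝ} (hε0 : 0 ≤ ε)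
    (hε1 : ε < 1) {x : F} (hx : x ∈ hv.nearSubring σ hε0 hε1.le) (h1 : v x = 1) :
    x⁻¹ ∈ hv.nearSubring σ hε0 hε1.le := by
  refine ⟨by rw [map_inv₀, h1, inv_one], ?_⟩
  have h2 := hv.map_div_sub_div_le σ (x := 1) v.map_one.le hx.1
    (by simpa using hε0) hx.2 (h1 ▸ hε1)
  simpa [h1] using h2

end IsNonarchimedean

lemma map_sub_le_pow_mul (σ : F ≃+* F) {π : F} (hπ0 : π ≠ 0)
    (hπ1 : v π < 1) (hσπ : σ π = π) {n : ℕ} (h : ∀ x, v x ≤ 1 → v (σ x - x) ≤ v π ^ (n + 1))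
    (x : F) : v (σ x - x) ≤ v π ^ n * v x := by
  rcases eq_or_ne x 0 with rfl | hx
  · simp
  have hπ : 0 < v π := v.pos hπ0
  obtain ⟨m, hm1, hm2⟩ := exists_mem_Ico_zpow (v.pos hx) ((one_lt_inv₀ hπ).2 hπ1)
  have hpos : 0 < v π ^ (m + 1) := zpow_pos hπ _
  have h1 := h (π ^ (m + 1) * x) (by
    rw [map_mul, map_zpow₀]
    rw [inv_zpow] at hm2
    exact ((mul_lt_mul_of_pos_left hm2 hpos).trans_eq (mul_inv_cancel₀ hpos.ne')).le)
  rw [map_mul, map_zpow₀, hσπ, ← mul_sub, map_mul, map_zpow₀] at h1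
  have h2 : v π ≤ v π ^ (m + 1) * v x := by
    rw [inv_zpow] at hm1
    calc v π = v π ^ (m + 1) * (v π ^ m)⁻¹ := by
          rw [zpow_add_one₀ hπ.ne']
          field_simp
      _ ≤ _ := mul_le_mul_of_nonneg_left hm1 hpos.le
  refine le_of_mul_le_mul_left ?_ hpos
  calc v π ^ (m + 1) * v (σ x - x) ≤ v π ^ n * v π := h1.trans_eq (pow_succ _ _)
    _ ≤ v π ^ n * (v π ^ (m + 1) * v x) := mul_le_mul_of_nonneg_left h2 (pow_nonneg hπ.le _)
    _ = _ := by ring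

/-- A congruence subgroup of a group acting on a finitely generated ring has finite index. -/
lemma exists_finiteIndex_map_sub_le {G : Type*} [Group G] {S : Set F} (hS : S.Finite)
    (hv : IsNonarchimedean v) (hS1 : ∀ x ∈ Subring.closure S, v x ≤ 1) {ε : ℝ}
    {I : Ideal (Subring.closure S)} (hI : ∀ x, x ∈ I ↔ v x ≤ ε)
    (hfin : Finite (Subring.closure S ⧸ I)) (τ : G →* (F ≃+* F))
    (hτ : ∀ g, ∀ x ∈ Subring.closure S, τ g x ∈ Subring.closure S) :
    ∃ G₀ : Subgroup G, G₀.FiniteIndex ∧ ∀ g ∈ G₀, ∀ x ∈ Subring.closure S,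
      v (τ g x - x) ≤ ε := by
  have hε : 0 ≤ ε := by simpa using (hI 0).1 I.zero_mem
  have hinv : ∀ g x, τ g⁻¹ (τ g x) = x := fun g x => by
    rw [← RingAut.mul_apply, ← map_mul, inv_mul_cancel, map_one]; rfl
  have hinv' : ∀ g x, τ g (τ g⁻¹ x) = x := fun g x => by
    rw [← RingAut.mul_apply, ← map_mul, mul_inv_cancel, map_one]; rfl
  let G₀ : Subgroup G :=
    { carrier := {g | ∀ x ∈ Subring.closure S, v (τ g x - x) ≤ ε}
      one_mem' := fun x _ => by simpa using hε
      mul_mem' := fun {g h} hg hh x hx => by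
        have := hv.map_add_le_of_le (hg _ (hτ h x hx)) (hh x hx)
        rwa [sub_add_sub_cancel, ← RingAut.mul_apply, ← map_mul] at this
      inv_mem' := fun {g} hg x hx => by
        have := hg _ (hτ g⁻¹ x hx)
        rwa [hinv', v.map_sub] at this }
  refine ⟨G₀, ?_, fun g hg => hg⟩
  let f : G → S → Subring.closure S ⧸ I := fun g s =>
    Ideal.Quotient.mk I ⟨τ g⁻¹ s, hτ _ _ (Subring.subset_closure s.2)⟩
  have hf : ∀ g h, f g = f h → g⁻¹ * h ∈ G₀ := by
    intro g h hgh
    have key : ∀ x ∈ Subring.closure S, v (τ g⁻¹ x - τ h⁻¹ x) ≤ ε := by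
      intro x hx
      induction hx using Subring.closure_induction with
      | mem x hx => exact (hI _).1 (Ideal.Quotient.eq.1 (congrFun hgh ⟨x, hx⟩))
      | zero => simpa using hε
      | one => simpa using hε
      | add x y _ _ hx hy =>
        rw [map_add, map_add, add_sub_add_comm]
        exact hv.map_add_le_of_le hx hy
      | neg x _ hx => rwa [map_neg, map_neg, ← neg_sub', v.map_neg]
      | mul x y hx' hy' hx hy =>
        rw [map_mul, map_mul, show τ g⁻¹ x * τ g⁻¹ y - τ h⁻¹ x * τ h⁻¹ y =
          τ g⁻¹ x * (τ g⁻¹ y - τ h⁻¹ y) + (τ g⁻¹ x - τ h⁻¹ x) * τ h⁻¹ y by ring]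
        refine hv.map_add_le_of_le ?_ ?_
        · rw [map_mul]
          exact (mul_le_of_le_one_left (v.nonneg _) (hS1 _ (hτ _ _ hx'))).trans hy
        · rw [map_mul]
          exact (mul_le_of_le_one_right (v.nonneg _) (hS1 _ (hτ _ _ hy'))).trans hx
    intro x hx
    have := key _ (hτ h x hx)
    rwa [hinv, ← RingAut.mul_apply, ← map_mul] at this
  rw [Subgroup.finiteIndex_iff_finite_quotient]
  have := hS.to_subtype
  refine Finite.of_injective (fun q : G ⧸ G₀ => f q.out) fun q r hqr => ?_
  rw [← q.out_eq, ← r.out_eq]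
  exact QuotientGroup.eq.2 (hf _ _ hqr)

end Congruence

section ModelTheorem

open MvPolynomial

lemma Subring.closure_preimage_val {R : Type*} [Ring R] (S : Set R) :
    Subring.closure (Subtype.val ⁻¹' S : Set (Subring.closure S)) = ⊤ := by
  refine eq_top_iff.2 fun x _ => ?_
  obtain ⟨x, hx⟩ := x
  induction hx using Subring.closure_induction with
  | mem x hx => exact Subring.subset_closure hx
  | zero => exact Subring.zero_mem _
  | one => exact Subring.one_mem _
  | add x y hx' hy' hx hy => exact Subring.add_mem _ (hx trivial) (hy trivial)
  | neg x hx' hx => exact Subring.neg_mem _ (hx trivial)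
  | mul x y hx' hy' hx hy => exact Subring.mul_mem _ (hx trivial) (hy trivial)

lemma MvPolynomial.isIntegralElem_aeval_map {R R' ι : Type*} [CommRing R] [CommRing R']
    (π : R →+* R') {t : ι → R} {Y : MvPolynomial ι ℤ} {a : R}
    (h : (aeval t : _ →ₐ[ℤ] R).toRingHom.IsIntegralElem (aeval t Y * a)) :
    (aeval fun i => π (t i) : _ →ₐ[ℤ] R').toRingHom.IsIntegralElem
      (aeval (fun i => π (t i)) Y * π a) := by
  obtain ⟨P, hP, hPa⟩ := h
  have hval : ∀ f : MvPolynomial ι ℤ, aeval (fun i => π (t i)) f = π (aeval t f) := fun f =>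
    DFunLike.congr_fun (MvPolynomial.ringHom_ext
      (f := (aeval (fun i => π (t i)) : _ →ₐ[ℤ] _).toRingHom)
      (g := π.comp (aeval t : _ →ₐ[ℤ] _).toRingHom)
      (by simp) (by simp)) f
  have h2 := congrArg π hPa
  rw [Polynomial.hom_eval₂, map_zero] at h2
  have h3 : (aeval (fun i => π (t i)) : _ →ₐ[ℤ] _).toRingHom =
      π.comp (aeval t : _ →ₐ[ℤ] _).toRingHom := RingHom.ext hval
  refine ⟨P, hP, ?_⟩
  rw [h3, hval, ← map_mul]
  exact h2

/-- The quotients of a finitely generated ring by the congruence ideals of the absolute values of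
`exists_absoluteValue_of_presentation` are finite. -/
lemma finite_quotient_of_presentation {F : Type*} [Field F] {S T : Set F}
    (hS : S.Finite) (hTS : T ⊆ S) {Y : MvPolynomial T ℤ}
    (hint : ∀ a ∈ S, (aeval (Subtype.val : T → F) : _ →ₐ[ℤ] F).toRingHom.IsIntegralElem
        (aeval (Subtype.val : T → F) Y * a)) {p : ℕ} {c : T → ℤ} {v : AbsoluteValue F ℝ}
    (hp : p.Prime) (hpY : ¬ (p : ℤ) ∣ eval c Y) (hc : ∀ i : T, v (i - c i) ≤ v p) {j : ℕ}
    {I : Ideal (Subring.closure S)} (hI : ∀ x, x ∈ I ↔ v x ≤ v p ^ j) :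
    Finite (Subring.closure S ⧸ I) := by
  let tB : T → Subring.closure S := fun i => ⟨i, Subring.subset_closure (hTS i.2)⟩
  let π := Ideal.Quotient.mk I
  have hval : ∀ f : MvPolynomial T ℤ,
      ((aeval tB f : Subring.closure S) : F) = aeval (Subtype.val : T → F) f := fun f =>
    DFunLike.congr_fun (MvPolynomial.ringHom_ext
      (f := (Subring.closure S).subtype.comp (aeval tB : _ →ₐ[ℤ] _).toRingHom)
      (g := (aeval (Subtype.val : T → F) : _ →ₐ[ℤ] F).toRingHom)
      (by simp) (by simp [tB])) f
  have hSfin : (Subtype.val ⁻¹' S : Set (Subring.closure S)).Finite :=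
    hS.preimage Subtype.val_injective.injOn
  refine finite_of_isIntegralElem (hSfin.image π) ?_ (fun i => π (tB i)) c
    (j := j) hp ?_ (fun i => ⟨j, ?_⟩) Y hpY ?_
  · rw [← RingHom.map_closure, Subring.closure_preimage_val, ← RingHom.range_eq_map,
      RingHom.range_eq_top]
    exact Ideal.Quotient.mk_surjective
  · rw [← map_natCast π, ← map_pow, Ideal.Quotient.eq_zero_iff_mem, hI]
    push_cast
    rw [map_pow]
  · rw [← map_intCast π, ← map_sub, ← map_pow, Ideal.Quotient.eq_zero_iff_mem, hI]
    push_cast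
    rw [map_pow]
    exact pow_le_pow_left₀ (v.nonneg _) (hc i) j
  · rintro _ ⟨a, ha, rfl⟩
    obtain ⟨P, hP, hPa⟩ := hint a ha
    refine MvPolynomial.isIntegralElem_aeval_map π ⟨P, hP, ?_⟩
    have h1 : P.eval₂ (aeval tB : _ →ₐ[ℤ] Subring.closure S).toRingHom (aeval tB Y * a) = 0 := by
      apply Subtype.val_injective
      change (Subring.closure S).subtype _ = 0
      rw [Polynomial.hom_eval₂]
      have h2 : (Subring.closure S).subtype.comp (aeval tB : _ →ₐ[ℤ] _).toRingHom =
          (aeval (Subtype.val : T → F) : _ →ₐ[ℤ] F).toRingHom := RingHom.ext hval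
      have h3 : (Subring.closure S).subtype (aeval tB Y * a) =
          aeval (Subtype.val : T → F) Y * a := congrArg (· * (a : F)) (hval Y)
      rw [h2, h3, hPa]
    exact h1

/-- A group of automorphisms of a finitely generated domain of characteristic zero virtually acts
by automorphisms close to the identity for some nonarchimedean absolute value. -/
theorem exists_absoluteValue_near {F G : Type*} [Field F] [CharZero F] [Group G] {S : Set F}
    (hS : S.Finite)
    (hfrac : ∀ x : F, ∃ a ∈ Subring.closure S, ∃ b ∈ Subring.closure S, b ≠ 0 ∧ x = a / b)
    (τ : G →* (F ≃+* F)) (hτ : ∀ g, ∀ x ∈ Subring.closure S, τ g x ∈ Subring.closure S) :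
    ∃ (G₀ : Subgroup G) (p : ℕ) (v : AbsoluteValue F ℝ), G₀.FiniteIndex ∧ p ≠ 0 ∧
      IsNonarchimedean v ∧ v p < 1 ∧ ∀ g ∈ G₀, ∀ x, v (τ g x - x) ≤ v p ^ 2 * v x := by
  obtain ⟨T, hTS, Y, hY0, hT, hint⟩ := exists_integral_presentation hS hfrac
  obtain ⟨p, c, v, hp, hpY, hv, hp1, hc, hS1, n, hn, hO⟩ :=
    exists_absoluteValue_of_presentation hS hTS hfrac hY0 hT hint
  have hp' : (p : F) ≠ 0 := Nat.cast_ne_zero.2 hp.ne_zero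
  have hp0 : 0 < v p := v.pos hp'
  choose a ha b hb hb0 hab using hfrac
  obtain ⟨j, hj4, hj⟩ : ∃ j : ℕ, 4 ≤ j ∧ ∀ z ∈ n, v p ^ j < v p ^ 3 * v (b z) ^ 2 := by
    have hex : ∀ z, ∃ N : ℕ, v p ^ N < v p ^ 3 * v (b z) ^ 2 := fun z =>
      exists_pow_lt_of_lt_one (mul_pos (pow_pos hp0 _) (pow_pos (v.pos (hb0 z)) _)) hp1
    choose N hN using hex
    refine ⟨4 + ∑ z ∈ n, N z, Nat.le_add_right _ _, fun z hz => ?_⟩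
    refine (pow_le_pow_of_le_one hp0.le hp1.le ?_).trans_lt (hN z)
    exact (Finset.single_le_sum (fun _ _ => Nat.zero_le _) hz).trans (Nat.le_add_left _ _)
  let I : Ideal (Subring.closure S) :=
    { carrier := {x | v x ≤ v p ^ j}
      add_mem' := fun hx hy => hv.map_add_le_of_le hx hy
      zero_mem' := by simp [hp0.le]
      smul_mem' := fun x y hy => by
        change v (x * y : F) ≤ _
        rw [map_mul]
        exact (mul_le_of_le_one_left (v.nonneg _) (hS1 _ x.2)).trans hy }
  have hI : ∀ x, x ∈ I ↔ v x ≤ v p ^ j := fun x => Iff.rfl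
  obtain ⟨G₀, hG₀, hnear⟩ := exists_finiteIndex_map_sub_le hS hv hS1 hI
    (finite_quotient_of_presentation hS hTS hint hp hpY hc hI) τ hτ
  refine ⟨G₀, p, v, hG₀, hp.ne_zero, hv, hp1, fun g hg => ?_⟩
  refine map_sub_le_pow_mul _ hp' hp1 (map_natCast _ _) ?_
  have hε : v p ^ (2 + 1) < 1 := pow_lt_one₀ hp0.le hp1 (by norm_num)
  have hε0 : 0 ≤ v p ^ (2 + 1) := pow_nonneg hp0.le _
  suffices h : ∀ x, v x ≤ 1 → x ∈ hv.nearSubring (τ g) hε0 hε.le from fun x hx => (h x hx).2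
  refine hO _ (fun i => ⟨?_, ?_⟩) (fun z hz => ⟨hn z hz, ?_⟩)
    fun x hx h1 => hv.inv_mem_nearSubring _ hε0 hε hx h1
  · rw [map_div₀]
    exact div_le_one_of_le₀ (hc i) hp0.le
  · rw [map_div₀ (τ g), map_sub (τ g), map_natCast, map_intCast, ← sub_div,
      sub_sub_sub_cancel_right, map_div₀, div_le_iff₀ hp0, ← pow_succ]
    exact (hnear g hg _ (Subring.subset_closure (hTS i.2))).trans
      (pow_le_pow_of_le_one hp0.le hp1.le hj4)
  · have hb1 := hS1 _ (hb z)
    have hlt : v p ^ j < v (b z) := by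
      refine (hj z hz).trans_le ?_
      calc v p ^ 3 * v (b z) ^ 2 ≤ 1 * v (b z) ^ 2 :=
            mul_le_mul_of_nonneg_right hε.le (sq_nonneg _)
        _ ≤ v (b z) := by
            rw [one_mul, sq]
            exact mul_le_of_le_one_left (v.nonneg _) hb1
    have h1 := hv.map_div_sub_div_le (τ g) (hS1 _ (ha z)) hb1 (hnear g hg _ (ha z))
      (hnear g hg _ (hb z)) hlt
    rw [← hab] at h1
    refine h1.trans ?_
    rw [div_le_iff₀ (pow_pos (v.pos (hb0 z)) _)]
    exact (hj z hz).le

end ModelTheorem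

theorem exists_finite_mem_closure {k A : Type*} [CommRing k] [CommRing A] [Algebra k A]
    {S : Set A} {x : A} (hx : x ∈ Algebra.adjoin k S) :
    ∃ C : Set k, C.Finite ∧ x ∈ Subring.closure (S ∪ algebraMap k A '' C) := by
  have hmono (C D E : Set k) (h : C ⊆ E) : Subring.closure (S ∪ algebraMap k A '' C) ≤
      Subring.closure (S ∪ algebraMap k A '' E) :=
    Subring.closure_mono (Set.union_subset_union_right _ (Set.image_mono h))
  induction hx using Algebra.adjoin_induction with
  | mem x hx => exact ⟨∅, Set.finite_empty, Subring.subset_closure (Or.inl hx)⟩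
  | algebraMap r =>
    exact ⟨{r}, Set.finite_singleton r, Subring.subset_closure (Or.inr ⟨r, rfl, rfl⟩)⟩
  | add x y _ _ hx hy =>
    obtain ⟨C, hC, hx⟩ := hx
    obtain ⟨D, hD, hy⟩ := hy
    exact ⟨C ∪ D, hC.union hD, add_mem (hmono C D _ Set.subset_union_left hx)
      (hmono D C _ Set.subset_union_right hy)⟩
  | mul x y _ _ hx hy =>
    obtain ⟨C, hC, hx⟩ := hx
    obtain ⟨D, hD, hy⟩ := hy
    exact ⟨C ∪ D, hC.union hD, mul_mem (hmono C D _ Set.subset_union_left hx)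
      (hmono D C _ Set.subset_union_right hy)⟩

theorem exists_finite_subset_closure {k A : Type*} [CommRing k] [CommRing A] [Algebra k A]
    {S X : Set A} (hX : X.Finite) (hXS : X ⊆ Algebra.adjoin k S) :
    ∃ C : Set k, C.Finite ∧ X ⊆ Subring.closure (S ∪ algebraMap k A '' C) := by
  choose! C hC hmem using fun x (hx : x ∈ X) => exists_finite_mem_closure (hXS hx)
  refine ⟨⋃ x ∈ X, C x, hX.biUnion hC, fun x hx => ?_⟩
  exact Subring.closure_mono (Set.union_subset_union_right _
    (Set.image_mono (Set.subset_biUnion_of_mem hx))) (hmem x hx)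

theorem exists_finite_monic_coeff_mem_closure {k A : Type*} [CommRing k] [CommRing A]
    [Algebra k A] {S : Set A} {x : A} (hx : IsIntegral (Algebra.adjoin k S) x) :
    ∃ C : Set k, C.Finite ∧ ∃ q : Polynomial A, q.Monic ∧ q.eval x = 0 ∧
      ∀ n, q.coeff n ∈ Subring.closure (S ∪ algebraMap k A '' C) := by
  obtain ⟨q, hq, hqx⟩ := hx
  set q' := q.map (algebraMap (Algebra.adjoin k S) A) with hq'
  obtain ⟨C, hC, hsub⟩ := exists_finite_subset_closure (k := k) (S := S)
    (X := q'.coeffs) q'.coeffs.finite_toSet (by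
      intro y hy
      obtain ⟨n, -, rfl⟩ := Polynomial.mem_coeffs_iff.1 (Finset.mem_coe.1 hy)
      rw [hq', Polynomial.coeff_map]
      exact (q.coeff n).2)
  refine ⟨C, hC, q', hq.map _, by rwa [hq', Polynomial.eval_map], fun n => ?_⟩
  by_cases hn : q'.coeff n = 0
  · rw [hn]; exact zero_mem _
  · exact hsub (Polynomial.coeff_mem_coeffs hn)

theorem map_mem_closure_of_generators {A H : Type*} [CommRing A] [Group H]
    {R : Type*} [CommRing R] [Algebra R A] (ρ : H →* (A ≃ₐ[R] A)) {T : Set H}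
    (hT : Subgroup.closure T = ⊤) {S : Set A}
    (hS : ∀ h ∈ T, ∀ x ∈ S,
      ρ h x ∈ Subring.closure S ∧ ρ h⁻¹ x ∈ Subring.closure S) (h : H) {x : A}
    (hx : x ∈ Subring.closure S) : ρ h x ∈ Subring.closure S := by
  have key (g : H) (hg : ∀ x ∈ S, ρ g x ∈ Subring.closure S) :
      ∀ x ∈ Subring.closure S, ρ g x ∈ Subring.closure S := by
    intro x hx
    have : Subring.closure S ≤ (Subring.closure S).comap (ρ g : A →+* A) :=
      Subring.closure_le.2 hg
    exact this hx
  suffices h' : ∀ x ∈ Subring.closure S,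
      ρ h x ∈ Subring.closure S ∧ ρ h⁻¹ x ∈ Subring.closure S from (h' x hx).1
  have hmem : h ∈ Subgroup.closure T := hT ▸ Subgroup.mem_top h
  induction hmem using Subgroup.closure_induction with
  | mem g hg => exact fun x hx => ⟨key g (fun x hx => (hS g hg x hx).1) x hx,
      key g⁻¹ (fun x hx => (hS g hg x hx).2) x hx⟩
  | one => simp
  | mul g g' _ _ hg hg' =>
    intro x hx
    rw [mul_inv_rev, map_mul, map_mul]
    exact ⟨(hg _ (hg' x hx).1).1, (hg' _ (hg x hx).2).2⟩
  | inv g _ hg =>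
    intro x hx
    rw [inv_inv]
    exact (hg x hx).symm

/-- The action of a group on an invariant subring. -/
def restrictAction {A H R : Type*} [CommRing A] [Group H] [CommRing R] [Algebra R A]
    (ρ : H →* (A ≃ₐ[R] A)) (B : Subring A) (hB : ∀ h, ∀ x ∈ B, ρ h x ∈ B) :
    H →* (B ≃+* B) where
  toFun h :=
    { toFun := fun x => ⟨ρ h x, hB h x x.2⟩
      invFun := fun x => ⟨ρ h⁻¹ x, hB h⁻¹ x x.2⟩
      left_inv := fun x => Subtype.ext (by simp [map_inv])
      right_inv := fun x => Subtype.ext (by simp [map_inv])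
      map_mul' := fun x y => Subtype.ext (map_mul (ρ h) x.1 y.1)
      map_add' := fun x y => Subtype.ext (map_add (ρ h) x.1 y.1) }
  map_one' := by ext; simp
  map_mul' g h := by ext; simp

theorem ringKrullDim_le_of_isIntegral_of_injective {R S : Type*} [CommRing R] [CommRing S]
    [Algebra R S] [Algebra.IsIntegral R S] (hinj : Function.Injective (algebraMap R S)) {n : ℕ}
    (hn : (n : WithBot ℕ∞) ≤ ringKrullDim R) : (n : WithBot ℕ∞) ≤ ringKrullDim S := by
  obtain ⟨l, rfl⟩ := Order.le_krullDim_iff.1 hn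
  obtain ⟨P, -, hP, hPl⟩ := Ideal.exists_ideal_over_prime_of_isIntegral
    (S := S) l.head.asIdeal (⊥ : Ideal S) (by
      intro x hx
      have h0 : algebraMap R S x = 0 := hx
      rw [hinj (h0.trans (map_zero _).symm)]
      exact zero_mem _)
  have : P.LiesOver l.head.asIdeal := ⟨hPl.symm⟩
  obtain ⟨L, hL, -⟩ := Ideal.exists_ltSeries_of_hasGoingUp l P
  exact Order.le_krullDim_iff.2 ⟨L, hL⟩

theorem exists_isIntegral_adjoin_range {k A : Type*} [Field k] [CommRing A] [IsDomain A]
    [Algebra k A] [Algebra.FiniteType k A] {d : ℕ} (hd : ringKrullDim A = d) :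
    ∃ s : Fin d → A, ∀ x : A, IsIntegral (Algebra.adjoin k (Set.range s)) x := by
  obtain ⟨n, g, hinj, hint⟩ := exists_integral_inj_algHom_of_fg k A
  have hn : n ≤ d := by
    let _ : Algebra (MvPolynomial (Fin n) k) A := g.toRingHom.toAlgebra
    have : Algebra.IsIntegral (MvPolynomial (Fin n) k) A := ⟨hint⟩
    have h := ringKrullDim_le_of_isIntegral_of_injective (R := MvPolynomial (Fin n) k) (S := A)
      hinj (n := n) (by
        rw [MvPolynomial.ringKrullDim_of_isNoetherianRing, ringKrullDim_eq_zero_of_field]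
        simp)
    rw [hd] at h
    exact_mod_cast h
  refine ⟨fun i => if h : i.1 < n then g (MvPolynomial.X ⟨i, h⟩) else 0, fun x => ?_⟩
  set s : Fin d → A := fun i => if h : i.1 < n then g (MvPolynomial.X ⟨i, h⟩) else 0
  have hmem (f : MvPolynomial (Fin n) k) : g f ∈ Algebra.adjoin k (Set.range s) := by
    have hle : (⊤ : Subalgebra k (MvPolynomial (Fin n) k)) ≤
        (Algebra.adjoin k (Set.range s)).comap g := by
      rw [← MvPolynomial.adjoin_range_X, Algebra.adjoin_le_iff]
      rintro _ ⟨i, rfl⟩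
      exact Algebra.subset_adjoin ⟨⟨i, i.2.trans_le hn⟩, dif_pos i.2⟩
    exact hle (Algebra.mem_top (x := f))
  obtain ⟨q, hq, hqx⟩ := hint x
  refine ⟨q.map (g.codRestrict _ hmem).toRingHom, hq.map _, ?_⟩
  rw [Polynomial.eval₂_map]
  exact hqx

theorem isAlgebraic_of_monic_coeff_mem {A F : Type*} [CommRing A] [Field F] {B : Subring A}
    (f : B →+* F) (K : Subfield F) {q : Polynomial A} (hq : q.Monic) {x : B}
    (hx : q.eval (x : A) = 0) (hqB : ∀ n, q.coeff n ∈ B)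
    (hK : ∀ n, f ⟨q.coeff n, hqB n⟩ ∈ K) : IsAlgebraic K (f x) := by
  have hsub : (q.coeffs : Set A) ⊆ B := by
    intro y hy
    obtain ⟨n, -, rfl⟩ := Polynomial.mem_coeffs_iff.1 (Finset.mem_coe.1 hy)
    exact hqB n
  have heval : (q.toSubring B hsub).eval x = 0 := by
    apply Subtype.val_injective
    have := Polynomial.hom_eval₂ (q.toSubring B hsub) (RingHom.id B) B.subtype x
    rw [RingHom.comp_id, ← Polynomial.eval_map B.subtype, Polynomial.map_toSubring] at this
    exact this.trans hx
  set r := (q.toSubring B hsub).map f with hr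
  have hrK : (r.coeffs : Set F) ⊆ K.toSubring := by
    intro y hy
    obtain ⟨n, -, rfl⟩ := Polynomial.mem_coeffs_iff.1 (Finset.mem_coe.1 hy)
    rw [hr, Polynomial.coeff_map,
      show (q.toSubring B hsub).coeff n = ⟨q.coeff n, hqB n⟩ from
        Subtype.ext (Polynomial.coeff_toSubring q B hsub)]
    exact hK n
  have hmonic : r.Monic := ((Polynomial.monic_toSubring q B hsub).2 hq).map f
  refine IsIntegral.isAlgebraic ⟨r.toSubring K.toSubring hrK,
    (Polynomial.monic_toSubring r K.toSubring hrK).2 hmonic, ?_⟩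
  rw [← Polynomial.eval_map]
  change (Polynomial.map K.toSubring.subtype _).eval _ = 0
  rw [Polynomial.map_toSubring, hr, Polynomial.eval_map, Polynomial.eval₂_hom, heval, map_zero]

/-- **Bound on the virtual derived length of nilpotent group actions.** Let `k` be a field of
characteristic zero, `A` an integral domain finitely generated as a `k`-algebra with Krull
dimension `d`, and `H` a finitely generated nilpotent group acting faithfully on `Spec A` by
`k`-algebra automorphisms. Then the virtual derived length of `H` is at most `d`: some
finite-index subgroup `H₀` of `H` satisfies `D_d(H₀) = 1`. -/
theorem vdl_le_dim_of_nilpotent_action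
    (k : Type*) [Field k] [CharZero k]
    (A : Type*) [CommRing A] [IsDomain A] [Algebra k A]
    (hfg : Algebra.FiniteType k A)
    (d : ℕ) (hdim : ringKrullDim A = d)
    (H : Type*) [Group H] [Group.IsNilpotent H] (hHfg : Group.FG H)
    (ρ : H →* (A ≃ₐ[k] A)) (hρ : Function.Injective ρ) :
    ∃ H₀ : Subgroup H, H₀.FiniteIndex ∧ derivedSeries H₀ d = ⊥ := by
  obtain ⟨T, hT, hTfin⟩ := Group.fg_iff.1 hHfg
  obtain ⟨G, hG⟩ := hfg.out
  obtain ⟨s, hs⟩ := exists_isIntegral_adjoin_range (k := k) hdim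
  set Y : Set A := Set.range s ∪ (G : Set A)
  have hYfin : Y.Finite := (Set.finite_range s).union G.finite_toSet
  have hYtop : Algebra.adjoin k Y = ⊤ :=
    top_le_iff.1 (hG.symm.le.trans (Algebra.adjoin_mono Set.subset_union_right))
  -- finitely many constants suffice for the action and for the integral equations
  obtain ⟨C₁, hC₁, hact⟩ := exists_finite_subset_closure (k := k) (S := Y)
    (X := ⋃ h ∈ T, (ρ h '' Y ∪ ρ h⁻¹ '' Y))
    (hTfin.biUnion fun h _ => (hYfin.image _).union (hYfin.image _))
    (fun x _ => hYtop ▸ Algebra.mem_top)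
  choose C hC q hq hqx hqC using fun x : A => exists_finite_monic_coeff_mem_closure (hs x)
  set D : Set k := C₁ ∪ ⋃ x ∈ Y, C x
  have hDfin : D.Finite := hC₁.union (hYfin.biUnion fun x _ => hC x)
  set S : Set A := Y ∪ algebraMap k A '' D
  have hSfin : S.Finite := hYfin.union (hDfin.image _)
  have hstable : ∀ h, ∀ x ∈ Subring.closure S, ρ h x ∈ Subring.closure S := by
    have hle : Subring.closure (Y ∪ algebraMap k A '' C₁) ≤ Subring.closure S :=
      Subring.closure_mono (Set.union_subset_union_right _ (Set.image_mono
        Set.subset_union_left))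
    refine fun h x => map_mem_closure_of_generators ρ hT ?_ h
    rintro h hh x (hx | ⟨c, hc, rfl⟩)
    · exact ⟨hle (hact (Set.mem_biUnion hh (Or.inl ⟨x, hx, rfl⟩))),
        hle (hact (Set.mem_biUnion hh (Or.inr ⟨x, hx, rfl⟩)))⟩
    · rw [AlgEquiv.commutes, AlgEquiv.commutes]
      have := Subring.subset_closure (s := S) (Or.inr ⟨c, hc, rfl⟩)
      exact ⟨this, this⟩
  have hcoeff : ∀ x ∈ Y, ∀ n,
      (q x).coeff n ∈ Subring.closure (Set.range s ∪ algebraMap k A '' D) := fun x hx n =>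
    Subring.closure_mono (Set.union_subset_union_right _ (Set.image_mono
      ((Set.subset_biUnion_of_mem (u := fun x => C x) hx).trans Set.subset_union_right)))
      (hqC x n)
  have hBS : Subring.closure (Set.range s ∪ algebraMap k A '' D) ≤ Subring.closure S :=
    Subring.closure_mono (Set.union_subset_union_left _ Set.subset_union_left)
  set A₀ : Subring A := Subring.closure S
  let F := FractionRing A₀
  have hinjF : Function.Injective (algebraMap A₀ F) := IsFractionRing.injective A₀ F
  have : CharZero A := charZero_of_injective_algebraMap (algebraMap k A).injective
  have : CharZero F := charZero_of_injective_algebraMap hinjF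
  let τ : H →* (F ≃+* F) :=
    (IsFractionRing.ringEquivOfRingEquivHom A₀ F).comp (restrictAction ρ A₀ hstable)
  have hτalg (h : H) (x : A₀) :
      τ h (algebraMap A₀ F x) = algebraMap A₀ F (restrictAction ρ A₀ hstable h x) :=
    IsFractionRing.ringEquivOfRingEquiv_algebraMap _ x
  have hτ : Function.Injective τ := by
    intro g h hgh
    refine hρ (AlgEquiv.coe_toAlgHom_injective (AlgHom.ext_of_adjoin_eq_top hYtop fun x hx => ?_))
    have hxA : x ∈ A₀ := Subring.subset_closure (Or.inl hx)
    have := DFunLike.congr_fun hgh (algebraMap A₀ F ⟨x, hxA⟩)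
    rw [hτalg, hτalg] at this
    exact congrArg Subtype.val (hinjF this)
  set S' : Set F := algebraMap A₀ F '' (Subtype.val ⁻¹' S) with hS'
  have hclos : Subring.closure S' = (algebraMap A₀ F).range := by
    have htop : Subring.closure (Subtype.val ⁻¹' S : Set A₀) = ⊤ := by
      refine eq_top_iff.2 fun x _ => ?_
      have hle : A₀ ≤ (Subring.closure (Subtype.val ⁻¹' S : Set A₀)).map A₀.subtype :=
        Subring.closure_le.2 fun y hy =>
          ⟨⟨y, Subring.subset_closure hy⟩, Subring.subset_closure hy, rfl⟩
      obtain ⟨y, hy, hyx⟩ := hle x.2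
      exact Subtype.val_injective hyx ▸ hy
    rw [hS', ← RingHom.map_closure, htop, RingHom.range_eq_map]
  obtain ⟨H₀, p, v, hH₀, hp, hv, hvp, hnear⟩ := exists_absoluteValue_near
    (S := S') ((hSfin.preimage Subtype.val_injective.injOn).image _)
    (fun x => by
      obtain ⟨a, b, hb, rfl⟩ := IsFractionRing.div_surjective (A := A₀) x
      rw [hclos]
      exact ⟨_, ⟨a, rfl⟩, _, ⟨b, rfl⟩, by
        rw [Ne, map_eq_zero_iff _ hinjF]; exact nonZeroDivisors.ne_zero hb, rfl⟩)
    τ (by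
      rw [hclos]
      rintro g _ ⟨x, rfl⟩
      exact ⟨_, (hτalg g x).symm⟩)
  refine ⟨H₀, hH₀, derivedSeries_eq_bot_of_absoluteValue v hv (p := p) (τ := τ.comp H₀.subtype)
    (hτ.comp H₀.subtype_injective) hp hvp (fun g => hnear g g.2)
    (fun i => algebraMap A₀ F
      ⟨s i, Subring.subset_closure (Or.inl (Or.inl ⟨i, rfl⟩))⟩) ?_⟩
  intro K hfix hsK hclosed
  have hconst (c : k) (hc : algebraMap k A c ∈ A₀) : algebraMap A₀ F ⟨_, hc⟩ ∈ K := by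
    refine hfix _ fun g => (hτalg g _).trans (congrArg _ (Subtype.ext ?_))
    exact AlgEquiv.commutes _ c
  have hB (x : A) (hx : x ∈ Subring.closure (Set.range s ∪ algebraMap k A '' D)) :
      algebraMap A₀ F ⟨x, hBS hx⟩ ∈ K := by
    induction hx using Subring.closure_induction with
    | mem x hx =>
      obtain ⟨i, rfl⟩ | ⟨c, -, rfl⟩ := hx
      · exact hsK i
      · exact hconst c _
    | zero => exact (map_zero (algebraMap A₀ F)).symm ▸ zero_mem K
    | one => exact (map_one (algebraMap A₀ F)).symm ▸ one_mem K
    | add x y hx hy hx' hy' =>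
      exact (map_add (algebraMap A₀ F) ⟨x, hBS hx⟩ ⟨y, hBS hy⟩).symm ▸ add_mem hx' hy'
    | neg x hx hx' => exact (map_neg (algebraMap A₀ F) ⟨x, hBS hx⟩).symm ▸ neg_mem hx'
    | mul x y hx hy hx' hy' =>
      exact (map_mul (algebraMap A₀ F) ⟨x, hBS hx⟩ ⟨y, hBS hy⟩).symm ▸ mul_mem hx' hy'
  have hA₀K (x : A) (hx : x ∈ A₀) : algebraMap A₀ F ⟨x, hx⟩ ∈ K := by
    induction hx using Subring.closure_induction with
    | mem x hx =>
      obtain hx | ⟨c, -, rfl⟩ := hx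
      · exact hclosed _ (isAlgebraic_of_monic_coeff_mem _ K (hq x) (hqx x)
          (fun n => hBS (hcoeff x hx n)) fun n => hB _ (hcoeff x hx n))
      · exact hconst c _
    | zero => exact (map_zero (algebraMap A₀ F)).symm ▸ zero_mem K
    | one => exact (map_one (algebraMap A₀ F)).symm ▸ one_mem K
    | add x y hx hy hx' hy' =>
      exact (map_add (algebraMap A₀ F) ⟨x, hx⟩ ⟨y, hy⟩).symm ▸ add_mem hx' hy'
    | neg x hx hx' => exact (map_neg (algebraMap A₀ F) ⟨x, hx⟩).symm ▸ neg_mem hx'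
    | mul x y hx hy hx' hy' =>
      exact (map_mul (algebraMap A₀ F) ⟨x, hx⟩ ⟨y, hy⟩).symm ▸ mul_mem hx' hy'
  refine eq_top_iff.2 fun x _ => ?_
  obtain ⟨a, b, -, rfl⟩ := IsFractionRing.div_surjective (A := A₀) x
  exact div_mem (hA₀K _ a.2) (hA₀K _ b.2)
end

section
/- There exists a finitely generated nilpotent subgroup H of Aut(A²_ℂ), the group of polynomial automorphisms of the complex affine plane, such that no finite-index subgroup of H is abelian; hence the virtual derived length of H equals 2, showing that the bound vdl(H) ≤ dim X for faithful nilpotent actions on complex varieties is optimal in dimension 2. -/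
open MvPolynomial in
/-- The automorphism `x ↦ x + m`, `y ↦ y + n x + p` of `ℂ[x,y]`. -/
noncomputable def unipotentAut (m n p : ℂ) :
    MvPolynomial (Fin 2) ℂ ≃ₐ[ℂ] MvPolynomial (Fin 2) ℂ :=
  AlgEquiv.ofAlgHom
    (aeval ![X 0 + C m, X 1 + C n * X 0 + C p])
    (aeval ![X 0 + C (-m), X 1 + C (-n) * X 0 + C (n * m - p)])
    (by
      ext1 i
      fin_cases i
      · simp
      · simp
        ring)
    (by
      ext1 i
      fin_cases i
      · simp
      · simp
        ring)

namespace unipotentAut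

open MvPolynomial
open scoped commutatorElement

@[simp]
theorem apply_X_zero (m n p : ℂ) : unipotentAut m n p (X 0) = X 0 + C m := by
  simp [unipotentAut]

@[simp]
theorem apply_X_one (m n p : ℂ) :
    unipotentAut m n p (X 1) = X 1 + C n * X 0 + C p := by
  simp [unipotentAut]

@[simp]
theorem apply_C (m n p c : ℂ) : unipotentAut m n p (C c) = C c :=
  (unipotentAut m n p).commutes c

theorem algEquiv_ext {f g : MvPolynomial (Fin 2) ℂ ≃ₐ[ℂ] MvPolynomial (Fin 2) ℂ}
    (h₀ : f (X 0) = g (X 0)) (h₁ : f (X 1) = g (X 1)) : f = g := by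
  have h : (f : MvPolynomial (Fin 2) ℂ →ₐ[ℂ] MvPolynomial (Fin 2) ℂ) = g := by
    ext1 i
    fin_cases i
    · exact h₀
    · exact h₁
  exact AlgEquiv.ext fun x => DFunLike.congr_fun h x

theorem mul_eq (m n p m' n' p' : ℂ) :
    unipotentAut m n p * unipotentAut m' n' p' =
      unipotentAut (m + m') (n + n') (p + p' + n' * m) := by
  apply algEquiv_ext
  · simp [AlgEquiv.mul_apply]
    ring
  · simp [AlgEquiv.mul_apply]
    ring

theorem zero_eq_one : unipotentAut 0 0 0 = 1 := by
  apply algEquiv_ext <;> simp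

theorem inv_eq (m n p : ℂ) :
    (unipotentAut m n p)⁻¹ = unipotentAut (-m) (-n) (n * m - p) := by
  rw [inv_eq_iff_mul_eq_one, mul_eq, ← zero_eq_one]
  congr 1 <;> ring

theorem pow_translation (k : ℕ) : unipotentAut 1 0 0 ^ k = unipotentAut k 0 0 := by
  induction k with
  | zero => simp [zero_eq_one]
  | succ k ih => simp [pow_succ, ih, mul_eq]

theorem pow_shear (k : ℕ) : unipotentAut 0 1 0 ^ k = unipotentAut 0 k 0 := by
  induction k with
  | zero => simp [zero_eq_one]
  | succ k ih => simp [pow_succ, ih, mul_eq]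

theorem mul_eq_of_commute {m n p m' n' p' : ℂ}
    (h : unipotentAut m n p * unipotentAut m' n' p' =
      unipotentAut m' n' p' * unipotentAut m n p) : n' * m = n * m' := by
  rw [mul_eq, mul_eq] at h
  have h₁ := congrArg (fun f => aeval (fun _ => (0 : ℂ)) (f (X 1))) h
  simp at h₁
  linear_combination h₁

theorem exists_eq_of_mem_closure
    {g : MvPolynomial (Fin 2) ℂ ≃ₐ[ℂ] MvPolynomial (Fin 2) ℂ}
    (hg : g ∈ Subgroup.closure {unipotentAut 1 0 0, unipotentAut 0 1 0}) :
    ∃ m n p, g = unipotentAut m n p := by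
  induction hg using Subgroup.closure_induction with
  | mem x hx =>
    rcases hx with rfl | rfl
    · exact ⟨_, _, _, rfl⟩
    · exact ⟨_, _, _, rfl⟩
  | one => exact ⟨0, 0, 0, zero_eq_one.symm⟩
  | mul x y _ _ hx hy =>
    obtain ⟨m, n, p, rfl⟩ := hx
    obtain ⟨m', n', p', rfl⟩ := hy
    exact ⟨_, _, _, mul_eq ..⟩
  | inv x _ hx =>
    obtain ⟨m, n, p, rfl⟩ := hx
    exact ⟨_, _, _, inv_eq ..⟩

theorem commutatorElement_eq (m n p m' n' p' : ℂ) :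
    ⁅unipotentAut m n p, unipotentAut m' n' p'⁆ =
      unipotentAut 0 0 (n' * m - n * m') := by
  rw [commutatorElement_def, mul_inv_eq_iff_eq_mul, mul_inv_eq_iff_eq_mul, mul_eq, mul_eq,
    mul_eq]
  congr 1 <;> ring

theorem commutator_closure_le_center :
    commutator (Subgroup.closure {unipotentAut 1 0 0, unipotentAut 0 1 0}) ≤
      Subgroup.center _ := by
  rw [commutator_def, Subgroup.commutator_le]
  rintro ⟨a, ha⟩ - ⟨b, hb⟩ -
  rw [Subgroup.mem_center_iff]
  rintro ⟨c, hc⟩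
  obtain ⟨m, n, p, rfl⟩ := exists_eq_of_mem_closure ha
  obtain ⟨m', n', p', rfl⟩ := exists_eq_of_mem_closure hb
  obtain ⟨m'', n'', p'', rfl⟩ := exists_eq_of_mem_closure hc
  apply Subtype.ext
  change unipotentAut m'' n'' p'' * ⁅unipotentAut m n p, unipotentAut m' n' p'⁆ =
    ⁅unipotentAut m n p, unipotentAut m' n' p'⁆ * unipotentAut m'' n'' p''
  rw [commutatorElement_eq, mul_eq, mul_eq]
  congr 1 <;> ring

end unipotentAut


/-- **Optimality in dimension 2.** There exists a finitely generated nilpotent subgroup `H` of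
the group of polynomial automorphisms of the complex affine plane (the `ℂ`-algebra
automorphisms of `ℂ[x,y]`) whose derived length is `2` and such that no finite-index subgroup
of `H` is abelian; hence the virtual derived length of `H` equals `2`. -/
theorem exists_nilpotent_subgroup_vdl_two :
    ∃ H : Subgroup (MvPolynomial (Fin 2) ℂ ≃ₐ[ℂ] MvPolynomial (Fin 2) ℂ),
      Group.FG H ∧ Group.IsNilpotent H ∧
      derivedSeries H 2 = ⊥ ∧
      ∀ K : Subgroup H, K.FiniteIndex → ¬(∀ a ∈ K, ∀ b ∈ K, a * b = b * a) := by
  set a := unipotentAut 1 0 0 with ha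
  set b := unipotentAut 0 1 0 with hb
  have hcenter := unipotentAut.commutator_closure_le_center
  refine ⟨Subgroup.closure {a, b}, ?_, ?_, ?_, ?_⟩
  · rw [Group.fg_iff_subgroup_fg]
    exact (Subgroup.fg_iff _).2 ⟨{a, b}, rfl, Set.toFinite _⟩
  · refine ⟨2, eq_top_iff.2 fun x _ => ?_⟩
    rw [Subgroup.mem_upperCentralSeries_succ_iff]
    intro y
    rw [Subgroup.upperCentralSeries_one]
    exact hcenter (Subgroup.commutator_mem_commutator trivial trivial)
  · rw [derivedSeries_succ, derivedSeries_one, Subgroup.commutator_eq_bot_iff_le_centralizer]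
    exact hcenter.trans (Subgroup.center_le_centralizer _)
  · intro K hK hcomm
    have haH : a ∈ Subgroup.closure {a, b} := Subgroup.subset_closure (by simp)
    have hbH : b ∈ Subgroup.closure {a, b} := Subgroup.subset_closure (by simp)
    obtain ⟨k, hk, -, hak⟩ :=
      Subgroup.exists_pow_mem_of_index_ne_zero hK.index_ne_zero ⟨a, haH⟩
    obtain ⟨l, hl, -, hbl⟩ :=
      Subgroup.exists_pow_mem_of_index_ne_zero hK.index_ne_zero ⟨b, hbH⟩
    have h := congrArg Subtype.val (hcomm _ hak _ hbl)
    change a ^ k * b ^ l = b ^ l * a ^ k at h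
    rw [ha, hb, unipotentAut.pow_translation, unipotentAut.pow_shear] at h
    have h₁ := unipotentAut.mul_eq_of_commute h
    simp at h₁
    omega
end
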